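/- arXiv:1712.05340 — 8 statements merged into one kernel-verified Lean document; each statement's English description precedes it below -/
import Mathlib

section
/- Let θ be a primitive random substitution with nonempty RS-subshift X_θ. Then either X_θ is substitutive (i.e. X_θ = X_φ for some primitive deterministic substitution φ), or there are infinitely many pairwise distinct substitutive subspaces of X_θ. -/
namespace RS

variable {A : Type*} {V : Type*}

/-- The set of realisations of a random substitution applied (once) to a word. -/
def real (θ : A → Set (List A)) : List A → Set (List A)
  | [] => {[]}
  | a :: w => {u | ∃ v ∈ θ a, ∃ r ∈ real θ w, u = v ++ r}

/-- The set of realisations of the `k`-th power of a random substitution on a word. -/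
def realPow (θ : A → Set (List A)) : ℕ → List A → Set (List A)
  | 0, w => {w}
  | k + 1, w => ⋃ v ∈ real θ w, realPow θ k v

/-- `θ` is a random substitution: each letter has a nonempty finite set of
nonempty realisations. -/
def IsRandomSubst (θ : A → Set (List A)) : Prop :=
  ∀ a, (θ a).Nonempty ∧ (θ a).Finite ∧ ∀ u ∈ θ a, u ≠ []

/-- Primitivity of a random substitution. -/
def Primitive (θ : A → Set (List A)) : Prop :=
  ∃ k : ℕ, ∀ a b : A, ∃ v ∈ realPow θ k [b], a ∈ v

/-- `θ`-legal words. -/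
def Legal (θ : A → Set (List A)) (u : List A) : Prop :=
  ∃ (k : ℕ) (a : A) (v : List A), v ∈ realPow θ k [a] ∧ u <:+: v

/-- The subword of a bi-infinite sequence starting at `i` of length `n`. -/
def subwordAt (x : ℤ → A) (i : ℤ) (n : ℕ) : List A :=
  List.ofFn fun j : Fin n => x (i + (j : ℤ))

/-- The RS-subshift of a random substitution. -/
def X (θ : A → Set (List A)) : Set (ℤ → A) :=
  {x | ∀ (i : ℤ) (n : ℕ), Legal θ (subwordAt x i n)}

/-- The left shift on bi-infinite sequences. -/
def shift (x : ℤ → A) : ℤ → A := fun i => x (i + 1)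

/-- The words of length `n` in the language of a subshift. -/
def lang (Y : Set (ℤ → A)) (n : ℕ) : Set (List A) :=
  {u | u.length = n ∧ ∃ x ∈ Y, ∃ i : ℤ, u = subwordAt x i n}

/-- Topological entropy of a subshift. -/
noncomputable def entropy (Y : Set (ℤ → A)) : ℝ :=
  Filter.limsup (fun n : ℕ => Real.log ((lang Y n).ncard) / n) Filter.atTop

/-- Source of a list of edges. -/
def src (γ : List (V × V)) : Option V := γ.head?.map Prod.fst

/-- Target of a list of edges. -/
def tgt (γ : List (V × V)) : Option V := γ.getLast?.map Prod.snd

/-- A (nonempty) path in the directed graph with edge set `E`. -/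
def IsPath (E : Set (V × V)) (γ : List (V × V)) : Prop :=
  γ ≠ [] ∧ (∀ e ∈ γ, e ∈ E) ∧ γ.Chain' fun e f => e.2 = f.1

/-- A cycle: a path whose source equals its target. -/
def IsCycle (E : Set (V × V)) (γ : List (V × V)) : Prop :=
  IsPath E γ ∧ src γ = tgt γ

/-- A simple path/cycle: the sources of its edges are pairwise distinct. -/
def IsSimple (γ : List (V × V)) : Prop := (γ.map Prod.fst).Nodup

/-- Strong connectivity. -/
def StronglyConnected (E : Set (V × V)) : Prop :=
  ∀ v w : V, ∃ γ : List (V × V), IsPath E γ ∧ src γ = some v ∧ tgt γ = some w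

/-- The word read of a cycle: the sources of its edges followed by its root. -/
def wordRead (γ : List (V × V)) : List V :=
  γ.map Prod.fst ++ (src γ).toList

/-- The cycle-substitution associated with the graph on the alphabet `A`
with edge set `E`. -/
def cycleSubst (E : Set (A × A)) (a : A) : Set (List A) :=
  {[a]} ∪ {u | ∃ γ : List (A × A), IsCycle E γ ∧ IsSimple γ ∧ src γ = some a ∧ u = wordRead γ}

/-- The word `w` applied under a deterministic substitution `φ`. -/
def detApply (φ : A → List A) (w : List A) : List A := (w.map φ).flatten

/-- Primitivity of a deterministic substitution. -/
def DetPrimitive (φ : A → List A) : Prop :=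
  ∃ k : ℕ, ∀ a b : A, b ∈ (detApply φ)^[k] [a]

/-- The subshift of a deterministic substitution. -/
def Xdet (φ : A → List A) : Set (ℤ → A) :=
  {x | ∀ (i : ℤ) (n : ℕ), ∃ (k : ℕ) (a : A), subwordAt x i n <:+: (detApply φ)^[k] [a]}

/-- Substitutive subshifts. -/
def Substitutive (Y : Set (ℤ → A)) : Prop :=
  ∃ φ : A → List A, (∀ a, φ a ≠ []) ∧ DetPrimitive φ ∧ Y = Xdet φ

/-- A factor map between subshifts. -/
def IsFactorMap {A B : Type*} [TopologicalSpace A] [TopologicalSpace B]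
    (Y : Set (ℤ → A)) (Z : Set (ℤ → B)) (f : Y → Z) : Prop :=
  Continuous f ∧ Function.Surjective f ∧
    ∀ (x : ℤ → A) (hx : x ∈ Y) (hx' : shift x ∈ Y),
      ((f ⟨shift x, hx'⟩ : Z) : ℤ → B) = shift ((f ⟨x, hx⟩ : Z) : ℤ → B)

end RS

namespace RS

section Realisations

variable {A : Type*} {θ : A → Set (List A)}

theorem append_mem_real {w w' v v' : List A} (h : v ∈ real θ w) (h' : v' ∈ real θ w') :
    v ++ v' ∈ real θ (w ++ w') := by
  induction w generalizing v with
  | nil =>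
    obtain rfl : v = [] := h
    exact h'
  | cons a w ih =>
    obtain ⟨p, hp, r, hr, rfl⟩ := h
    exact ⟨p, hp, r ++ v', ih hr, List.append_assoc _ _ _⟩

theorem mem_realPow_succ {k : ℕ} {w u : List A} :
    u ∈ realPow θ (k + 1) w ↔ ∃ v ∈ real θ w, u ∈ realPow θ k v := by
  simp [realPow]

theorem append_mem_realPow {k : ℕ} {w w' v v' : List A} (h : v ∈ realPow θ k w)
    (h' : v' ∈ realPow θ k w') : v ++ v' ∈ realPow θ k (w ++ w') := by
  induction k generalizing w w' with
  | zero =>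
    obtain rfl : v = w := h
    obtain rfl : v' = w' := h'
    rfl
  | succ k ih =>
    rw [mem_realPow_succ] at h h' ⊢
    obtain ⟨p, hp, hv⟩ := h
    obtain ⟨p', hp', hv'⟩ := h'
    exact ⟨p ++ p', append_mem_real hp hp', ih hv hv'⟩

theorem mem_realPow_add {j k : ℕ} {w u v : List A} (h : u ∈ realPow θ j w)
    (h' : v ∈ realPow θ k u) : v ∈ realPow θ (j + k) w := by
  induction j generalizing w with
  | zero =>
    obtain rfl : u = w := h
    simpa using h'
  | succ j ih =>
    rw [mem_realPow_succ] at h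
    obtain ⟨p, hp, hu⟩ := h
    rw [Nat.add_right_comm, mem_realPow_succ]
    exact ⟨p, hp, ih hu⟩

theorem nil_mem_realPow (k : ℕ) : [] ∈ realPow θ k [] := by
  induction k with
  | zero => rfl
  | succ k ih => exact mem_realPow_succ.2 ⟨[], rfl, ih⟩

theorem IsRandomSubst.exists_mem_real (hθ : IsRandomSubst θ) (w : List A) :
    ∃ v ∈ real θ w, w.length ≤ v.length := by
  induction w with
  | nil => exact ⟨[], rfl, le_rfl⟩
  | cons a w ih =>
    obtain ⟨r, hr, hl⟩ := ih
    obtain ⟨p, hp⟩ := (hθ a).1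
    have := List.length_pos_iff.2 ((hθ a).2.2 p hp)
    refine ⟨p ++ r, ⟨p, hp, r, hr, rfl⟩, ?_⟩
    simp only [List.length_cons, List.length_append]
    omega

theorem IsRandomSubst.exists_mem_realPow (hθ : IsRandomSubst θ) (k : ℕ) (w : List A) :
    ∃ v ∈ realPow θ k w, w.length ≤ v.length := by
  induction k generalizing w with
  | zero => exact ⟨w, rfl, le_rfl⟩
  | succ k ih =>
    obtain ⟨p, hp, hl⟩ := hθ.exists_mem_real w
    obtain ⟨v, hv, hl'⟩ := ih p
    exact ⟨v, mem_realPow_succ.2 ⟨p, hp, hv⟩, hl.trans hl'⟩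

theorem IsRandomSubst.exists_mem_realPow_append (hθ : IsRandomSubst θ) {k : ℕ}
    {u v : List A} (hv : v ∈ realPow θ k u) (s t : List A) :
    ∃ s' t', s.length ≤ s'.length ∧ t.length ≤ t'.length ∧
      s' ++ v ++ t' ∈ realPow θ k (s ++ u ++ t) := by
  obtain ⟨s', hs', hsl⟩ := hθ.exists_mem_realPow k s
  obtain ⟨t', ht', htl⟩ := hθ.exists_mem_realPow k t
  exact ⟨s', t', hsl, htl, append_mem_realPow (append_mem_realPow hs' hv) ht'⟩

/-- A realisation of `θ ^ k` on a subword of `w` extends to one on `w`. -/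
theorem IsRandomSubst.exists_infix_mem_realPow (hθ : IsRandomSubst θ) {k : ℕ}
    {u v w : List A} (hv : v ∈ realPow θ k u) (hu : u <:+: w) :
    ∃ v' ∈ realPow θ k w, v <:+: v' := by
  obtain ⟨s, t, rfl⟩ := hu
  obtain ⟨s', t', -, -, h⟩ := hθ.exists_mem_realPow_append hv s t
  exact ⟨_, h, List.infix_append _ _ _⟩

theorem legal_singleton (a : A) : Legal θ [a] := ⟨0, a, [a], rfl, List.infix_rfl⟩

/-- Under primitivity, a legal word occurs in some realisation of every large power of `θ` on
every letter. -/
theorem Legal.eventually_infix (hθ : IsRandomSubst θ) (hprim : Primitive θ) {u : List A}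
    (hu : Legal θ u) : ∃ N, ∀ K ≥ N, ∀ b, ∃ v ∈ realPow θ K [b], u <:+: v := by
  obtain ⟨k, a, v, hv, huv⟩ := hu
  obtain ⟨k₀, hk₀⟩ := hprim
  refine ⟨k₀ + k, fun K hK b => ?_⟩
  obtain ⟨m, rfl⟩ := Nat.exists_eq_add_of_le' hK
  obtain ⟨w, hw, hl⟩ := hθ.exists_mem_realPow m [b]
  obtain ⟨c, hc⟩ := List.exists_mem_of_length_pos (l := w) (Nat.lt_of_lt_of_le Nat.one_pos hl)
  obtain ⟨p, hp, hap⟩ := hk₀ a c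
  obtain ⟨q, hq, hvq⟩ := hθ.exists_infix_mem_realPow hv ((List.singleton_infix_iff _ _).2 hap)
  obtain ⟨r, hr, hqr⟩ := hθ.exists_infix_mem_realPow (mem_realPow_add hp hq)
    ((List.singleton_infix_iff _ _).2 hc)
  exact ⟨r, mem_realPow_add hw hr, huv.trans (hvq.trans hqr)⟩

/-- Finitely many legal words occur together in some realisation of every large power of `θ` on
every letter, provided a legal word of length two exists. -/
theorem eventually_infix_of_forall_legal (hθ : IsRandomSubst θ) (hprim : Primitive θ)
    {c d : A} (hcd : Legal θ [c, d]) (U : List (List A)) (hU : ∀ u ∈ U, Legal θ u) :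
    ∃ N, ∀ K ≥ N, ∀ b, ∃ v ∈ realPow θ K [b], ∀ u ∈ U, u <:+: v := by
  induction U with
  | nil =>
    refine ⟨0, fun K _ b => ?_⟩
    obtain ⟨v, hv, -⟩ := hθ.exists_mem_realPow K [b]
    exact ⟨v, hv, by simp⟩
  | cons u U ih =>
    obtain ⟨N, hN⟩ := ih fun u hu => hU u (List.mem_cons_of_mem _ hu)
    obtain ⟨M, hM⟩ := (hU u List.mem_cons_self).eventually_infix hθ hprim
    obtain ⟨L, hL⟩ := hcd.eventually_infix hθ hprim
    refine ⟨L + (M + N), fun K hK b => ?_⟩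
    obtain ⟨m, rfl⟩ := Nat.exists_eq_add_of_le' hK
    rw [← Nat.add_assoc m]
    obtain ⟨w, hw, hcw⟩ := hL (m + L) (by omega) b
    obtain ⟨p, hp, hup⟩ := hM (M + N) (by omega) c
    obtain ⟨q, hq, hUq⟩ := hN (M + N) (by omega) d
    obtain ⟨r, hr, hpr⟩ := hθ.exists_infix_mem_realPow (append_mem_realPow hp hq) hcw
    refine ⟨r, mem_realPow_add hw hr, ?_⟩
    rw [List.forall_mem_cons]
    exact ⟨hup.trans ((List.prefix_append p q).isInfix.trans hpr),
      fun u hu => (hUq u hu).trans ((List.suffix_append p q).isInfix.trans hpr)⟩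

end Realisations

section Subwords

variable {A : Type*}

@[simp] theorem length_subwordAt (x : ℤ → A) (i : ℤ) (n : ℕ) :
    (subwordAt x i n).length = n := by
  simp [subwordAt]

theorem subwordAt_add (x : ℤ → A) (i : ℤ) (m n : ℕ) :
    subwordAt x i (m + n) = subwordAt x i m ++ subwordAt x (i + m) n := by
  simp [subwordAt, List.ofFn_add, add_assoc]

theorem subwordAt_infix {x : ℤ → A} {i j : ℤ} {m n : ℕ} (hij : i ≤ j)
    (h : j + n ≤ i + m) : subwordAt x j n <:+: subwordAt x i m := by
  obtain ⟨a, rfl⟩ := Int.le.dest hij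
  obtain ⟨b, rfl⟩ : ∃ b, m = a + n + b := Nat.exists_eq_add_of_le (by omega)
  rw [subwordAt_add, subwordAt_add]
  exact List.infix_append _ _ _

theorem exists_eq_subwordAt_of_infix {x : ℤ → A} {i : ℤ} {n : ℕ} {u : List A}
    (h : u <:+: subwordAt x i n) : ∃ j, u = subwordAt x j u.length := by
  obtain ⟨s, t, h⟩ := h
  have hn : n = s.length + u.length + t.length := by
    simpa [add_assoc] using (congrArg List.length h).symm
  rw [hn, subwordAt_add, subwordAt_add] at h
  exact ⟨_, (List.append_inj (List.append_inj h (by simp)).1 (by simp)).2⟩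

/-- Words extending each other strictly on both sides converge to a bi-infinite sequence. -/
theorem exists_limit {W S T : ℕ → List A} (hW : W 0 ≠ []) (hS : ∀ n, S n ≠ [])
    (hT : ∀ n, T n ≠ []) (hWST : ∀ n, W (n + 1) = S n ++ W n ++ T n) :
    ∃ x : ℤ → A, (∀ n, ∃ i, subwordAt x i (W n).length = W n) ∧
      ∀ i k, ∃ n, subwordAt x i k <:+: W n := by
  let p : ℕ → ℕ := fun n => ∑ m ∈ Finset.range n, (S m).length
  have hp : ∀ n, p (n + 1) = p n + (S n).length := fun n => Finset.sum_range_succ _ _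
  have hpn : ∀ n, n ≤ p n := by
    intro n
    induction n with
    | zero => exact Nat.zero_le _
    | succ n ih =>
      have := hp n
      have := List.length_pos_iff.2 (hS n)
      omega
  have hln : ∀ n, p n + n < (W n).length := by
    intro n
    induction n with
    | zero => simpa [p] using List.length_pos_iff.2 hW
    | succ n ih =>
      have := hp n
      have := List.length_pos_iff.2 (hT n)
      simp only [hWST, List.length_append]
      omega
  let g : ℕ → ℤ → Option A := fun n i => (W n)[(p n + i).toNat]?
  have hstep : ∀ n (i : ℤ), 0 ≤ p n + i → p n + i < (W n).length → g (n + 1) i = g n i := by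
    intro n i h0 h1
    obtain ⟨q, hq⟩ := Int.eq_ofNat_of_zero_le h0
    have hq' : (p (n + 1) + i).toNat = (S n).length + q := by
      have := hp n
      omega
    have hq'' : (p n + i).toNat = q := by omega
    simp only [g, hq', hq'', hWST, List.append_assoc]
    rw [List.getElem?_append_right (by omega), Nat.add_sub_cancel_left,
      List.getElem?_append_left (by omega)]
  have hmono : ∀ n (i : ℤ), 0 ≤ p n + i → p n + i < (W n).length → ∀ m, n ≤ m → g m i = g n i := by
    intro n i h0 h1 m hm
    suffices h : (0 ≤ p m + i ∧ p m + i < (W m).length) ∧ g m i = g n i from h.2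
    induction m, hm using Nat.le_induction with
    | base => exact ⟨⟨h0, h1⟩, rfl⟩
    | succ m _ ih =>
      obtain ⟨⟨h2, h3⟩, h4⟩ := ih
      have := hp m
      refine ⟨⟨by omega, ?_⟩, (hstep m i h2 h3).trans h4⟩
      simp only [hWST, List.length_append]
      push_cast
      omega
  have hrange : ∀ i : ℤ, 0 ≤ p i.natAbs + i ∧ p i.natAbs + i < (W i.natAbs).length := by
    intro i
    have := hpn i.natAbs
    have := hln i.natAbs
    omega
  have hex : ∀ i : ℤ, ∃ a, g i.natAbs i = some a := by
    intro i
    obtain ⟨h0, h1⟩ := hrange i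
    exact ⟨_, List.getElem?_eq_getElem (by omega)⟩
  choose x hx using hex
  have hgx : ∀ n (i : ℤ), 0 ≤ p n + i → p n + i < (W n).length → g n i = some (x i) := by
    intro n i h0 h1
    obtain ⟨h2, h3⟩ := hrange i
    rw [← hmono n i h0 h1 _ (le_max_left n i.natAbs), ← hx,
      ← hmono i.natAbs i h2 h3 _ (le_max_right n i.natAbs)]
  have hWx : ∀ n, subwordAt x (-p n) (W n).length = W n := by
    intro n
    refine List.ext_getElem (by simp) fun j _ hj => ?_
    have := hgx n (-p n + j) (by omega) (by omega)
    simp only [g, add_neg_cancel_left, Int.toNat_natCast, List.getElem?_eq_getElem hj,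
      Option.some.injEq] at this
    simp [subwordAt, this]
  refine ⟨x, fun n => ⟨_, hWx n⟩, fun i k => ⟨i.natAbs + k, ?_⟩⟩
  rw [← hWx]
  have := hpn (i.natAbs + k)
  have := hln (i.natAbs + k)
  exact subwordAt_infix (by omega) (by omega)

end Subwords

section Deterministic

variable {A : Type*} {θ : A → Set (List A)} {φ : A → List A}

theorem detApply_append (w w' : List A) :
    detApply φ (w ++ w') = detApply φ w ++ detApply φ w' := by
  simp [detApply]

theorem iterate_detApply_append (n : ℕ) (w w' : List A) :
    (detApply φ)^[n] (w ++ w') = (detApply φ)^[n] w ++ (detApply φ)^[n] w' := by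
  induction n generalizing w w' with
  | zero => rfl
  | succ n ih => simp [detApply_append, ih]

@[simp] theorem detApply_singleton (a : A) : detApply φ [a] = φ a := by
  simp [detApply]

theorem iterate_detApply_ne_nil (hφ : ∀ a, φ a ≠ []) (n : ℕ) {w : List A} (hw : w ≠ []) :
    (detApply φ)^[n] w ≠ [] := by
  induction n generalizing w with
  | zero => exact hw
  | succ n ih =>
    refine ih ?_
    obtain ⟨a, w, rfl⟩ := List.exists_cons_of_ne_nil hw
    simp [detApply, hφ]

/-- If `φ a` contains `a` at an interior position, every subword of `φ a` occurs in a point of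
the subshift of `φ`. -/
theorem exists_mem_Xdet_of_infix (hφ : ∀ a, φ a ≠ []) {a : A} {s t : List A} (hs : s ≠ [])
    (ht : t ≠ []) (ha : φ a = s ++ [a] ++ t) {u : List A} (hu : u <:+: φ a) :
    ∃ x ∈ Xdet φ, ∃ j, u = subwordAt x j u.length := by
  obtain ⟨x, hx, hx'⟩ := exists_limit (W := fun n => (detApply φ)^[n] [a])
    (S := fun n => (detApply φ)^[n] s) (T := fun n => (detApply φ)^[n] t)
    (by simp) (fun n => iterate_detApply_ne_nil hφ n hs)
    (fun n => iterate_detApply_ne_nil hφ n ht)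
    (fun n => by rw [Function.iterate_succ_apply, detApply_singleton, ha,
      iterate_detApply_append, iterate_detApply_append])
  refine ⟨x, fun i n => ?_, ?_⟩
  · obtain ⟨k, hk⟩ := hx' i n
    exact ⟨k, a, hk⟩
  · obtain ⟨i, hi⟩ := hx 1
    rw [Function.iterate_one, detApply_singleton] at hi
    exact exists_eq_subwordAt_of_infix (hi ▸ hu)

theorem detApply_mem_realPow {K : ℕ} (hφ : ∀ a, φ a ∈ realPow θ K [a]) (w : List A) :
    detApply φ w ∈ realPow θ K w := by
  induction w with
  | nil => exact nil_mem_realPow K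
  | cons a w ih => simpa [detApply] using append_mem_realPow (hφ a) ih

theorem iterate_detApply_mem_realPow {K : ℕ} (hφ : ∀ a, φ a ∈ realPow θ K [a]) (k : ℕ)
    (w : List A) : (detApply φ)^[k] w ∈ realPow θ (k * K) w := by
  induction k with
  | zero => simp [realPow]
  | succ k ih =>
    rw [Function.iterate_succ_apply', Nat.succ_mul]
    exact mem_realPow_add ih (detApply_mem_realPow hφ _)

/-- The subshift of a marginal of a power of `θ` is contained in the RS-subshift of `θ`. -/
theorem Xdet_subset_X {K : ℕ} (hφ : ∀ a, φ a ∈ realPow θ K [a]) : Xdet φ ⊆ X θ := by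
  intro x hx i n
  obtain ⟨k, a, h⟩ := hx i n
  exact ⟨_, a, _, iterate_detApply_mem_realPow hφ k [a], h⟩

/-- Finitely many legal words all occur in points of a common substitutive subspace. -/
theorem exists_substitutive_subset_of_forall_legal [Finite A] (hθ : IsRandomSubst θ)
    (hprim : Primitive θ) (hne : (X θ).Nonempty) (U : List (List A))
    (hU : ∀ u ∈ U, Legal θ u) :
    ∃ Y, Substitutive Y ∧ Y ⊆ X θ ∧
      ∀ u ∈ U, ∃ y ∈ Y, ∃ j, u = subwordAt y j u.length := by
  have := Fintype.ofFinite A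
  obtain ⟨x, hx⟩ := hne
  obtain ⟨N, hN⟩ := eventually_infix_of_forall_legal hθ hprim (c := x 0) (d := x 1)
    (by simpa [subwordAt] using hx 0 2)
    (U ++ Finset.univ.toList.map fun a => [a]) (by
      intro u hu
      rcases List.mem_append.1 hu with hu | hu
      · exact hU u hu
      · obtain ⟨a, -, rfl⟩ := List.mem_map.1 hu
        exact legal_singleton a)
  obtain ⟨M, hM⟩ := (show Legal θ [x 0, x 1, x 2] by
    simpa [subwordAt] using hx 0 3).eventually_infix hθ hprim
  have key : ∀ b, ∃ v ∈ realPow θ (M + N) [b], ∃ s w t, v = s ++ w ++ t ∧ s ≠ [] ∧ t ≠ [] ∧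
      (∀ u ∈ U, u <:+: w) ∧ ∀ a, a ∈ w := by
    intro b
    obtain ⟨p, hp, s, t, rfl⟩ := hM M le_rfl b
    obtain ⟨w, hw, hwU⟩ := hN N le_rfl (x 1)
    obtain ⟨s', t', hs, ht, h⟩ :=
      hθ.exists_mem_realPow_append hw (s ++ [x 0]) ([x 2] ++ t)
    refine ⟨s' ++ w ++ t', mem_realPow_add hp (by simpa using h), s', w, t', rfl, ?_, ?_,
      fun u hu => hwU u (List.mem_append_left _ hu), fun a => ?_⟩
    · rintro rfl
      simp at hs
    · rintro rfl
      simp at ht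
    · exact (List.singleton_infix_iff _ _).1 (hwU [a] (List.mem_append_right _ (by simp)))
  choose φ hφ s w t hswt hs ht hw hall using key
  have hne : ∀ a, φ a ≠ [] := fun a => by simp [hswt, hs]
  refine ⟨Xdet φ, ⟨φ, hne, ⟨1, fun a b => ?_⟩, rfl⟩, Xdet_subset_X hφ, fun u hu => ?_⟩
  · simp [hswt, hall]
  · obtain ⟨l, r, hlr⟩ := List.append_of_mem (hall (x 0) (x 0))
    refine exists_mem_Xdet_of_infix hne (a := x 0) (s := s (x 0) ++ l) (t := r ++ t (x 0))
      (by simp [hs]) (by simp [ht]) (by rw [hswt, hlr]; simp) ?_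
    rw [hswt]
    exact (hw _ u hu).trans (List.infix_append _ _ _)

theorem Substitutive.exists_legal_not_occurring {Y : Set (ℤ → A)} (hY : Substitutive Y)
    (hYX : Y ⊂ X θ) :
    ∃ u, Legal θ u ∧ ∀ y ∈ Y, ∀ j n, u ≠ subwordAt y j n := by
  obtain ⟨φ, -, -, rfl⟩ := hY
  obtain ⟨x, hx, hxY⟩ := Set.exists_of_ssubset hYX
  simp only [Xdet, Set.mem_ofPred_eq, not_forall] at hxY
  obtain ⟨i, n, hin⟩ := hxY
  exact ⟨_, hx i n, fun y hy j m h => hin (h ▸ hy j m)⟩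

end Deterministic

end RS

/-- For a primitive random substitution with nonempty RS-subshift, either the
RS-subshift is substitutive, or it contains infinitely many distinct substitutive subspaces. -/
theorem stmt3 {A : Type*} [Fintype A]
    (θ : A → Set (List A)) (hrs : RS.IsRandomSubst θ) (hprim : RS.Primitive θ)
    (hne : (RS.X θ).Nonempty) :
    RS.Substitutive (RS.X θ) ∨
      {Y : Set (ℤ → A) | RS.Substitutive Y ∧ Y ⊆ RS.X θ}.Infinite := by
  by_contra! h
  obtain ⟨hX, hfin⟩ := h
  have hmiss : ∀ Y : Set (ℤ → A), ∃ u, RS.Legal θ u ∧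
      (RS.Substitutive Y ∧ Y ⊆ RS.X θ → ∀ y ∈ Y, ∀ j n, u ≠ RS.subwordAt y j n) := by
    intro Y
    by_cases hY : RS.Substitutive Y ∧ Y ⊆ RS.X θ
    · obtain ⟨u, hu, hu'⟩ := hY.1.exists_legal_not_occurring
        (hY.2.ssubset_of_ne fun h => hX (h ▸ hY.1))
      exact ⟨u, hu, fun _ => hu'⟩
    · obtain ⟨x, hx⟩ := hne
      exact ⟨_, hx 0 0, fun h => absurd h hY⟩
  choose f hf hf' using hmiss
  obtain ⟨Y, hY, hYX, hocc⟩ := RS.exists_substitutive_subset_of_forall_legal hrs hprim hne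
    (hfin.toFinset.toList.map f) (List.forall_mem_map.2 fun Y _ => hf Y)
  obtain ⟨y, hy, j, hj⟩ := hocc (f Y)
    (List.mem_map_of_mem (by simpa using And.intro hY hYX))
  exact hf' Y ⟨hY, hYX⟩ y hy j _ hj
end

section
/- Let G be a strongly connected finite directed graph with vertex set {v_a : a ∈ 𝒜} indexed by a finite alphabet 𝒜, and let γ be a cycle in G that is not simple. Suppose γ₀ is a simple subcycle of γ and γ̃ is the cycle obtained by removing γ₀ from γ. Then the word read u(γ) is a realisation of θ_G applied to u(γ̃), i.e. u(γ) ∈ θ_G(u(γ̃)). -/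
namespace RS

variable {A : Type*}

/-- Realisations may be concatenated. -/
theorem append_mem_real_s5 {θ : A → Set (List A)} {w₁ w₂ u₁ u₂ : List A}
    (h₁ : u₁ ∈ real θ w₁) (h₂ : u₂ ∈ real θ w₂) : u₁ ++ u₂ ∈ real θ (w₁ ++ w₂) := by
  induction w₁ generalizing u₁ with
  | nil =>
    have h : u₁ = [] := h₁
    simpa [h] using h₂
  | cons a w ih =>
    obtain ⟨v, hv, r, hr, rfl⟩ := h₁
    exact ⟨v, hv, r ++ u₂, ih hr, List.append_assoc _ _ _⟩

/-- A single letter is realised by any element of its image. -/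
theorem mem_real_singleton {θ : A → Set (List A)} {a : A} {u : List A} (h : u ∈ θ a) :
    u ∈ real θ [a] :=
  ⟨u, h, [], rfl, (List.append_nil u).symm⟩

/-- Every word is a realisation of itself under a cycle-substitution. -/
theorem self_mem_real_cycleSubst (E : Set (A × A)) (w : List A) :
    w ∈ real (cycleSubst E) w := by
  induction w with
  | nil => rfl
  | cons a w ih => exact ⟨[a], Or.inl rfl, w, ih, rfl⟩

/-- Inserting the word read of a simple cycle at an occurrence of its root yields a realisation
of the cycle-substitution. -/
theorem insert_cycle_mem_real {E : Set (A × A)} {γ : List (A × A)} {c : A}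
    (hγ : IsCycle E γ) (hs : IsSimple γ) (hc : src γ = some c) (x y : List A) :
    x ++ (γ.map Prod.fst ++ c :: y) ∈ real (cycleSubst E) (x ++ c :: y) := by
  refine append_mem_real_s5 (self_mem_real_cycleSubst E x) ?_
  have hmem : γ.map Prod.fst ++ [c] ∈ cycleSubst E c :=
    Or.inr ⟨γ, hγ, hs, hc, by simp [wordRead, hc]⟩
  simpa using append_mem_real_s5 (mem_real_singleton hmem) (self_mem_real_cycleSubst E y)

end RS

/-- Let `γ = pre ++ mid ++ post` be a non-simple cycle in a strongly connected
graph on the alphabet `A`, where `mid` is a simple subcycle and `pre ++ post` is the cycle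
obtained by removing `mid`.  Then the word read of `γ` is a realisation of the
cycle-substitution applied to the word read of `pre ++ post`. -/
theorem stmt5 {A : Type*} [Fintype A] (E : Set (A × A))
    (hsc : RS.StronglyConnected E)
    (pre mid post : List (A × A))
    (hγ : RS.IsCycle E (pre ++ mid ++ post))
    (hns : ¬ RS.IsSimple (pre ++ mid ++ post))
    (hmid : RS.IsCycle E mid) (hmids : RS.IsSimple mid)
    (hrem : RS.IsCycle E (pre ++ post)) :
    RS.wordRead (pre ++ mid ++ post) ∈
      RS.real (RS.cycleSubst E) (RS.wordRead (pre ++ post)) := by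
  obtain ⟨c, hc⟩ : ∃ c, RS.src mid = some c := by
    cases mid with
    | nil => exact absurd rfl hmid.1.1
    | cons e l => exact ⟨e.1, rfl⟩
  have hne : mid ≠ [] := hmid.1.1
  have ht : RS.tgt mid = some c := hmid.2 ▸ hc
  cases post with
  | nil =>
    have hroot : RS.src (pre ++ mid) = some c := by
      have h := hγ.2
      rw [List.append_nil] at h
      rw [h, ← ht]
      simp [RS.tgt, List.getLast?_append_of_ne_nil _ hne]
    have hpre : pre ≠ [] := by simpa using hrem.1.1
    have hsrc : RS.src pre = some c := by
      rw [← hroot]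
      simp [RS.src, List.head?_append_of_ne_nil _ hpre]
    simpa [RS.wordRead, hroot, hsrc] using
      RS.insert_cycle_mem_real hmid hmids hc (pre.map Prod.fst) []
  | cons e l =>
    have he : e.1 = c := by
      have hchain := hγ.1.2.2
      rw [List.append_assoc] at hchain
      have hjoin := (List.isChain_append.mp (List.isChain_append.mp hchain).2.1).2.2
      obtain ⟨f, hf, hfc⟩ := Option.map_eq_some_iff.mp ht
      exact (hjoin f hf e rfl).symm.trans hfc
    have hsrc : RS.src (pre ++ (mid ++ e :: l)) = RS.src (pre ++ e :: l) := by
      cases pre with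
      | nil =>
        have h : RS.src (mid ++ e :: l) = RS.src mid := by
          simp [RS.src, List.head?_append_of_ne_nil _ hne]
        rw [List.nil_append, h, hc, ← he]
        rfl
      | cons f k => rfl
    simpa [RS.wordRead, hsrc, he] using
      RS.insert_cycle_mem_real hmid hmids hc (pre.map Prod.fst)
        (l.map Prod.fst ++ (RS.src (pre ++ e :: l)).toList)
end

section
/- Let G be a strongly connected finite directed graph with vertex set {v_a : a ∈ 𝒜} indexed by a finite alphabet 𝒜, and let θ_G be the associated cycle-substitution. Then every θ_G-legal word a₁a₂⋯a_m satisfies (v_{a_i}, v_{a_{i+1}}) ∈ E for all 1 ≤ i ≤ m−1; consequently the RS-subshift X_{θ_G} is contained in the vertex shift X̂_G = {x ∈ 𝒜^ℤ : (v_{x_i}, v_{x_{i+1}}) ∈ E for all i ∈ ℤ}. -/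
namespace RS

variable {A : Type*}

/-- The sources of a path followed by its target form a chain of edges. -/
theorem IsPath.isChain_map_fst_append {E : Set (A × A)} {γ : List (A × A)} {b : A}
    (h : IsPath E γ) (hb : tgt γ = some b) :
    (γ.map Prod.fst ++ [b]).IsChain fun x y => (x, y) ∈ E := by
  induction γ with
  | nil => exact absurd rfl h.1
  | cons e γ ih =>
    obtain ⟨-, hE, hc⟩ := h
    have he : (e.1, e.2) ∈ E := hE e List.mem_cons_self
    cases γ with
    | nil =>
      obtain rfl : e.2 = b := by simpa [tgt] using hb
      simpa using he
    | cons f γ =>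
      change List.IsChain _ _ at hc
      rw [List.isChain_cons_cons] at hc
      have hrest := ih ⟨List.cons_ne_nil _ _, fun g hg => hE g (List.mem_cons_of_mem _ hg), hc.2⟩
        (by simpa [tgt] using hb)
      simp only [List.map_cons, List.cons_append, List.isChain_cons_cons] at hrest ⊢
      exact ⟨hc.1 ▸ he, hrest⟩

/-- A realisation of a letter under the cycle-substitution is a chain of edges which starts and
ends with that letter. -/
theorem isChain_of_mem_cycleSubst {E : Set (A × A)} {a : A} {v : List A}
    (hv : v ∈ cycleSubst E a) :
    v.IsChain (fun x y => (x, y) ∈ E) ∧ v.head? = some a ∧ v.getLast? = some a := by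
  rcases hv with rfl | ⟨γ, hγ, -, ha, rfl⟩
  · simp
  · refine ⟨?_, ?_, ?_⟩
    · simpa [wordRead, ha] using hγ.1.isChain_map_fst_append (hγ.2.symm.trans ha)
    · have ha' := ha
      simp only [src] at ha'
      simp [wordRead, ha, ha']
    · simp [wordRead, ha]

variable {θ : A → Set (List A)} {R : A → A → Prop}

/-- A substitution whose realisations of a letter are chains starting and ending with that letter
maps chains to chains. -/
theorem isChain_of_mem_real {w u : List A}
    (hθ : ∀ a, ∀ v ∈ θ a, v.IsChain R ∧ v.head? = some a ∧ v.getLast? = some a)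
    (hw : w.IsChain R) (hu : u ∈ real θ w) :
    u.IsChain R ∧ u.head? = w.head? := by
  induction w generalizing u with
  | nil =>
    obtain rfl : u = [] := hu
    simp
  | cons a w ih =>
    obtain ⟨v, hv, r, hr, rfl⟩ := hu
    obtain ⟨hc, hh, hl⟩ := hθ a v hv
    rw [List.isChain_cons] at hw
    obtain ⟨hrc, hrh⟩ := ih hw.2 hr
    refine ⟨hc.append hrc fun x hx y hy => ?_, by simp [hh]⟩
    rw [hl] at hx
    rw [hrh] at hy
    cases hx
    exact hw.1 y hy

theorem isChain_of_mem_realPow {k : ℕ} {w u : List A}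
    (hθ : ∀ a, ∀ v ∈ θ a, v.IsChain R ∧ v.head? = some a ∧ v.getLast? = some a)
    (hw : w.IsChain R) (hu : u ∈ realPow θ k w) : u.IsChain R := by
  induction k generalizing w with
  | zero =>
    obtain rfl : u = w := hu
    exact hw
  | succ k ih =>
    simp only [realPow, Set.mem_iUnion] at hu
    obtain ⟨v, hv, hu⟩ := hu
    exact ih (isChain_of_mem_real hθ hw hv).1 hu

theorem Legal.isChain {u : List A}
    (hθ : ∀ a, ∀ v ∈ θ a, v.IsChain R ∧ v.head? = some a ∧ v.getLast? = some a)
    (hu : Legal θ u) : u.IsChain R := by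
  obtain ⟨k, a, v, hv, huv⟩ := hu
  exact (isChain_of_mem_realPow hθ (List.isChain_singleton a) hv).infix huv

end RS

/-- Every word that is legal for the cycle-substitution of a strongly connected
graph reads off consecutive edges of the graph; consequently the RS-subshift of the
cycle-substitution is contained in the vertex shift of the graph. -/
theorem stmt6 {A : Type*} [Fintype A] (E : Set (A × A))
    (hsc : RS.StronglyConnected E) :
    (∀ u : List A, RS.Legal (RS.cycleSubst E) u → u.Chain' fun a b => (a, b) ∈ E) ∧
      RS.X (RS.cycleSubst E) ⊆ {x : ℤ → A | ∀ i : ℤ, (x i, x (i + 1)) ∈ E} := by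
  have hlegal : ∀ u : List A, RS.Legal (RS.cycleSubst E) u →
      u.IsChain fun a b => (a, b) ∈ E :=
    fun _ hu => RS.Legal.isChain (fun _ _ => RS.isChain_of_mem_cycleSubst) hu
  refine ⟨hlegal, fun x hx i => ?_⟩
  simpa [RS.subwordAt, List.ofFn_succ] using hlegal _ (hx i 2)
end

section
/- Let G be a strongly connected finite directed graph with vertex set {v_a : a ∈ 𝒜} indexed by a finite alphabet 𝒜. Then the cycle-substitution θ_G is primitive: there exists k ∈ ℕ such that for all a, b ∈ 𝒜 the letter b occurs as a subword of some realisation of θ_G^k(a). -/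
namespace RS

variable {A : Type*}

/-- Walks from a vertex to `a` in the directed graph with edge set `E`, as lists of edges. -/
inductive WalkTo (E : Set (A × A)) (a : A) : A → List (A × A) → Prop
  | nil : WalkTo E a a []
  | cons {c d : A} {γ : List (A × A)} (h : (c, d) ∈ E) (hγ : WalkTo E a d γ) :
      WalkTo E a c ((c, d) :: γ)

theorem WalkTo.exists_suffix {E : Set (A × A)} {a c d : A} {γ : List (A × A)}
    (h : WalkTo E a d γ) (hc : c ∈ γ.map Prod.fst) : ∃ γ', γ' <:+ γ ∧ WalkTo E a c γ' := by
  induction h with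
  | nil => simp at hc
  | @cons x y γ hxy hγ ih =>
    rw [List.map_cons, List.mem_cons] at hc
    rcases hc with rfl | hc
    · exact ⟨_, List.suffix_rfl, .cons hxy hγ⟩
    · obtain ⟨γ', hs, hγ'⟩ := ih hc
      exact ⟨γ', hs.trans (List.suffix_cons _ _), hγ'⟩

theorem exists_simple_walkTo {E : Set (A × A)} {a c : A}
    (h : Relation.ReflTransGen (fun x y => (x, y) ∈ E) c a) :
    ∃ γ, WalkTo E a c γ ∧ (a :: γ.map Prod.fst).Nodup := by
  induction h using Relation.ReflTransGen.head_induction_on with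
  | refl => exact ⟨[], .nil, by simp⟩
  | @head c d hcd _ ih =>
    obtain ⟨γ, hγ, hn⟩ := ih
    by_cases hca : c = a
    · subst hca
      exact ⟨[], .nil, by simp⟩
    by_cases hc : c ∈ γ.map Prod.fst
    · obtain ⟨γ', hs, hγ'⟩ := hγ.exists_suffix hc
      exact ⟨γ', hγ', hn.sublist ((hs.sublist.map _).cons_cons a)⟩
    · refine ⟨(c, d) :: γ, .cons hcd hγ, ?_⟩
      rw [List.nodup_cons] at hn
      rw [List.map_cons, List.nodup_cons, List.nodup_cons, List.mem_cons]
      exact ⟨by rintro (h | h); exacts [hca h.symm, hn.1 h], hc, hn.2⟩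

theorem WalkTo.isPath_cons {E : Set (A × A)} {a b c : A} {γ : List (A × A)}
    (h : WalkTo E a c γ) (hbc : (b, c) ∈ E) :
    IsPath E ((b, c) :: γ) ∧ tgt ((b, c) :: γ) = some a := by
  induction h generalizing b with
  | nil => exact ⟨⟨by simp, by simpa using hbc, List.isChain_singleton _⟩, rfl⟩
  | @cons c d γ hcd hγ ih =>
    obtain ⟨⟨_, hE, hch⟩, ht⟩ := ih hcd
    refine ⟨⟨by simp, ?_, List.IsChain.cons_cons rfl hch⟩, ?_⟩
    · intro e he
      rcases List.mem_cons.1 he with rfl | he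
      exacts [hbc, hE e he]
    · simpa [tgt] using ht

theorem IsPath.reflTransGen {E : Set (A × A)} {γ : List (A × A)} (h : IsPath E γ) {a b : A}
    (ha : src γ = some a) (hb : tgt γ = some b) :
    Relation.ReflTransGen (fun x y => (x, y) ∈ E) a b := by
  induction γ generalizing a with
  | nil => exact absurd rfl h.1
  | cons e γ ih =>
    obtain ⟨_, hE, hch⟩ := h
    obtain ⟨x, y⟩ := e
    obtain rfl : x = a := by simpa [src] using ha
    have hxy : (x, y) ∈ E := hE _ (by simp)
    cases γ with
    | nil =>
      obtain rfl : y = b := by simpa [tgt] using hb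
      exact .single hxy
    | cons f γ =>
      obtain ⟨h₁, h₂⟩ := List.isChain_cons_cons.1 hch
      refine .head hxy (ih ⟨by simp, fun e he => hE e (by simp [List.mem_cons.1 he]), h₂⟩ ?_ ?_)
      · simp_all [src]
      · simpa [tgt] using hb

/-- Every edge of a strongly connected graph lies on a simple cycle. -/
theorem exists_mem_cycleSubst {E : Set (A × A)} {a c : A} (hac : (a, c) ∈ E)
    (hca : Relation.ReflTransGen (fun x y => (x, y) ∈ E) c a) :
    ∃ v ∈ cycleSubst E a, c ∈ v := by
  obtain ⟨γ, hγ, hn⟩ := exists_simple_walkTo hca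
  obtain ⟨hp, ht⟩ := hγ.isPath_cons hac
  refine ⟨_, Or.inr ⟨(a, c) :: γ, ⟨hp, by simp [ht, src]⟩, hn, rfl, rfl⟩, ?_⟩
  cases hγ <;> simp [wordRead]

theorem mem_real_self {θ : A → Set (List A)} (hθ : ∀ a, [a] ∈ θ a) (w : List A) :
    w ∈ real θ w := by
  induction w with
  | nil => rfl
  | cons a w ih => exact ⟨[a], hθ a, w, ih, rfl⟩

theorem exists_mem_real {θ : A → Set (List A)} (hθ : ∀ a, [a] ∈ θ a) {w v : List A} {a c : A}
    (ha : a ∈ w) (hv : v ∈ θ a) (hc : c ∈ v) : ∃ u ∈ real θ w, c ∈ u := by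
  induction w with
  | nil => simp at ha
  | cons b w ih =>
    rcases List.mem_cons.1 ha with rfl | ha
    · exact ⟨v ++ w, ⟨v, hv, w, mem_real_self hθ w, rfl⟩, by simp [hc]⟩
    · obtain ⟨u, hu, hcu⟩ := ih ha
      exact ⟨[b] ++ u, ⟨[b], hθ b, u, hu, rfl⟩, by simp [hcu]⟩

theorem realPow_monotone {θ : A → Set (List A)} (hθ : ∀ a, [a] ∈ θ a) (w : List A) :
    Monotone fun n => realPow θ n w :=
  monotone_nat_of_le_succ fun _ _ hv => Set.mem_biUnion (mem_real_self hθ w) hv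

theorem exists_mem_realPow {θ : A → Set (List A)} (hθ : ∀ a, [a] ∈ θ a) {a b : A}
    (h : Relation.ReflTransGen (fun x y => ∃ v ∈ θ x, y ∈ v) b a) :
    ∃ n, ∀ w : List A, b ∈ w → ∃ v ∈ realPow θ n w, a ∈ v := by
  induction h using Relation.ReflTransGen.head_induction_on with
  | refl => exact ⟨0, fun w hw => ⟨w, rfl, hw⟩⟩
  | head hbc _ ih =>
    obtain ⟨n, hn⟩ := ih
    obtain ⟨v, hv, hc⟩ := hbc
    refine ⟨n + 1, fun w hw => ?_⟩
    obtain ⟨u, hu, hcu⟩ := exists_mem_real hθ hw hv hc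
    obtain ⟨z, hz, haz⟩ := hn u hcu
    exact ⟨z, Set.mem_biUnion hu hz, haz⟩

end RS

/-- The cycle-substitution of a strongly connected finite directed graph on the
alphabet `A` is primitive. -/
theorem stmt8 {A : Type*} [Fintype A] (E : Set (A × A))
    (hsc : RS.StronglyConnected E) : RS.Primitive (RS.cycleSubst E) := by
  have hθ : ∀ a, [a] ∈ RS.cycleSubst E a := fun a => Or.inl rfl
  have hconn : ∀ x y, Relation.ReflTransGen (fun x y => (x, y) ∈ E) x y := fun x y => by
    obtain ⟨γ, hγ, hx, hy⟩ := hsc x y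
    exact hγ.reflTransGen hx hy
  have hpow : ∀ p : A × A, ∃ n, ∃ v ∈ RS.realPow (RS.cycleSubst E) n [p.2], p.1 ∈ v := fun p => by
    obtain ⟨n, hn⟩ := RS.exists_mem_realPow hθ <| Relation.ReflTransGen.mono
      (fun x y hxy => RS.exists_mem_cycleSubst hxy (hconn y x)) _ _ (hconn p.2 p.1)
    exact ⟨n, hn _ (List.mem_singleton_self _)⟩
  choose n hn using hpow
  refine ⟨Finset.univ.sup n, fun a b => ?_⟩
  obtain ⟨v, hv, hav⟩ := hn (a, b)
  exact ⟨v, RS.realPow_monotone hθ _ (Finset.le_sup (Finset.mem_univ (a, b))) hv, hav⟩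
end

section
/- Let X ⊆ 𝒜^ℤ be a nonempty, topologically transitive shift of finite type over a finite alphabet 𝒜. Then there exist a finite alphabet ℬ and a primitive random substitution θ on ℬ such that the RS-subshift X_θ is topologically conjugate to X, i.e. there is a homeomorphism h : X_θ → X with h ∘ σ = σ ∘ h. -/
/-- `u` occurs as a subword of the bi-infinite sequence `x`. -/
def occursIn {A : Type*} (u : List A) (x : ℤ → A) : Prop :=
  ∃ i : ℤ, u = RS.subwordAt x i u.length

namespace RS

section Realisations

variable {A : Type*} {θ : A → Set (List A)}

theorem real_append {w₁ w₂ u₁ u₂ : List A} (h₁ : u₁ ∈ real θ w₁) (h₂ : u₂ ∈ real θ w₂) :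
    u₁ ++ u₂ ∈ real θ (w₁ ++ w₂) := by
  induction w₁ generalizing u₁ with
  | nil =>
    obtain rfl : u₁ = [] := h₁
    exact h₂
  | cons a w ih =>
    obtain ⟨v, hv, r, hr, rfl⟩ := h₁
    exact ⟨v, hv, r ++ u₂, ih hr, by simp⟩

theorem real_singleton {a : A} {u : List A} (h : u ∈ θ a) : u ∈ real θ [a] :=
  ⟨u, h, [], rfl, by simp⟩

theorem realPow_append {k : ℕ} {w₁ w₂ u₁ u₂ : List A} (h₁ : u₁ ∈ realPow θ k w₁)
    (h₂ : u₂ ∈ realPow θ k w₂) : u₁ ++ u₂ ∈ realPow θ k (w₁ ++ w₂) := by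
  induction k generalizing w₁ w₂ with
  | zero =>
    obtain rfl : u₁ = w₁ := h₁
    obtain rfl : u₂ = w₂ := h₂
    rfl
  | succ k ih =>
    simp only [realPow, Set.mem_iUnion, exists_prop] at h₁ h₂ ⊢
    obtain ⟨v₁, hv₁, h₁⟩ := h₁
    obtain ⟨v₂, hv₂, h₂⟩ := h₂
    exact ⟨v₁ ++ v₂, real_append hv₁ hv₂, ih h₁ h₂⟩

theorem realPow_add {k l : ℕ} {w v u : List A} (h₁ : v ∈ realPow θ k w)
    (h₂ : u ∈ realPow θ l v) : u ∈ realPow θ (k + l) w := by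
  induction k generalizing w with
  | zero =>
    obtain rfl : v = w := h₁
    simpa using h₂
  | succ k ih =>
    rw [Nat.add_right_comm]
    simp only [realPow, Set.mem_iUnion, exists_prop] at h₁ ⊢
    obtain ⟨t, ht, h₁⟩ := h₁
    exact ⟨t, ht, ih h₁⟩

theorem self_mem_real (hθ : ∀ a, [a] ∈ θ a) (w : List A) : w ∈ real θ w := by
  induction w with
  | nil => rfl
  | cons a w ih => exact ⟨[a], hθ a, w, ih, rfl⟩

theorem self_mem_realPow (hθ : ∀ a, [a] ∈ θ a) (k : ℕ) (w : List A) : w ∈ realPow θ k w := by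
  induction k with
  | zero => rfl
  | succ k ih =>
    simp only [realPow, Set.mem_iUnion, exists_prop]
    exact ⟨w, self_mem_real hθ w, ih⟩

theorem realPow_mono (hθ : ∀ a, [a] ∈ θ a) {k l : ℕ} (hkl : k ≤ l) (w : List A) :
    realPow θ k w ⊆ realPow θ l w := by
  intro u hu
  obtain ⟨m, rfl⟩ := Nat.exists_eq_add_of_le hkl
  exact realPow_add hu (self_mem_realPow hθ m u)

end Realisations

section Loops

variable {B : Type*} {R : B → B → Prop}

/-- Words spelling a closed walk based at `a` in the graph of `R`. -/
def IsLoop (R : B → B → Prop) (a : B) (w : List B) : Prop :=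
  w.IsChain R ∧ w.head? = some a ∧ w.getLast? = some a

/-- The random substitution replacing a letter by any short closed walk based at it. -/
def loopSubst [Fintype B] (R : B → B → Prop) (a : B) : Set (List B) :=
  {w | IsLoop R a w ∧ w.length ≤ Fintype.card B + 1}

theorem isLoop_singleton (a : B) : IsLoop R a [a] :=
  ⟨.singleton a, rfl, rfl⟩

theorem singleton_mem_loopSubst [Fintype B] (a : B) : [a] ∈ loopSubst R a :=
  ⟨isLoop_singleton a, by simp⟩

theorem isRandomSubst_loopSubst [Fintype B] : IsRandomSubst (loopSubst R) := fun a =>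
  ⟨⟨[a], singleton_mem_loopSubst a⟩,
    (List.finite_length_le B (Fintype.card B + 1)).subset fun _ h => h.2, by
      rintro u h rfl
      simpa using h.1.2.1⟩

theorem real_loopSubst [Fintype B] {w u : List B} (hw : w.IsChain R)
    (hu : u ∈ real (loopSubst R) w) :
    u.IsChain R ∧ u.head? = w.head? ∧ u.getLast? = w.getLast? := by
  induction w generalizing u with
  | nil =>
    obtain rfl : u = [] := hu
    simp
  | cons a w ih =>
    obtain ⟨v, ⟨⟨hv, hh, hl⟩, -⟩, r, hr, rfl⟩ := hu
    rw [List.isChain_cons] at hw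
    obtain ⟨h₁, h₂, h₃⟩ := ih hw.2 hr
    refine ⟨hv.append h₁ ?_, ?_, ?_⟩
    · rw [hl, h₂]
      simpa using hw.1
    · simp [hh]
    · rw [List.getLast?_append, h₃, hl]
      cases w <;> simp [List.getLast?_cons]

theorem realPow_loopSubst [Fintype B] {k : ℕ} {w u : List B} (hw : w.IsChain R)
    (hu : u ∈ realPow (loopSubst R) k w) : u.IsChain R := by
  induction k generalizing w with
  | zero =>
    obtain rfl : u = w := hu
    exact hw
  | succ k ih =>
    simp only [realPow, Set.mem_iUnion, exists_prop] at hu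
    obtain ⟨v, hv, hu⟩ := hu
    exact ih (real_loopSubst hw hv).1 hu

theorem exists_eq_append_of_not_nodup {l : List B} (h : ¬ l.Nodup) :
    ∃ a p q r, l = p ++ a :: q ++ a :: r := by
  induction l with
  | nil => simp at h
  | cons b l ih =>
    by_cases hb : b ∈ l
    · obtain ⟨q, r, rfl⟩ := List.append_of_mem hb
      exact ⟨b, [], q, r, rfl⟩
    · obtain ⟨a, p, q, r, rfl⟩ := ih (by simpa [hb] using h)
      exact ⟨a, b :: p, q, r, rfl⟩

theorem IsLoop.exists_mem_realPow [Fintype B] {a : B} {w : List B} (hw : IsLoop R a w) :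
    ∃ k, w ∈ realPow (loopSubst R) k [a] := by
  induction hn : w.length using Nat.strong_induction_on generalizing a w with
  | _ n ih =>
  by_cases hlen : w.length ≤ Fintype.card B + 1
  · refine ⟨1, ?_⟩
    simp only [realPow, Set.mem_iUnion, exists_prop]
    exact ⟨w, real_singleton ⟨hw, hlen⟩, rfl⟩
  obtain ⟨t, c, rfl⟩ := List.eq_nil_or_concat w |>.resolve_left (by rintro rfl; simp at hlen)
  have hdup : ¬ t.Nodup := fun h => hlen (by simpa using h.length_le_card)
  obtain ⟨b, p, q, r, rfl⟩ := exists_eq_append_of_not_nodup hdup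
  obtain ⟨hc, hh, hl⟩ := hw
  have hloop : IsLoop R b (b :: q ++ [b]) :=
    ⟨hc.infix ⟨p, r ++ [c], by simp⟩, by simp, by rw [List.getLast?_append]; rfl⟩
  have hshort : IsLoop R a (p ++ b :: (r ++ [c])) := by
    refine ⟨?_, ?_, ?_⟩
    · rw [List.isChain_split]
      constructor
      · exact hc.infix ⟨[], q ++ b :: (r ++ [c]), by simp⟩
      · exact hc.infix ⟨p ++ b :: q, [], by simp⟩
    · cases p <;> simpa using hh
    · simpa [List.getLast?_append, List.getLast?_cons] using hl
  obtain ⟨k, hk⟩ := ih _ (by simp at hn ⊢; omega) hshort rfl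
  obtain ⟨l, hl'⟩ := ih _ (by simp at hn ⊢; omega) hloop rfl
  refine ⟨k + l, realPow_add hk ?_⟩
  have hp := self_mem_realPow (θ := loopSubst R) singleton_mem_loopSubst l p
  have hr := self_mem_realPow (θ := loopSubst R) singleton_mem_loopSubst l (r ++ [c])
  simpa using realPow_append hp (realPow_append hl' hr)

theorem exists_isLoop_of_isChain (hR : ∀ a b, Relation.ReflTransGen R a b) {a : B} {w : List B}
    (hw : (a :: w).IsChain R) : ∃ v, IsLoop R a (a :: w ++ v) := by
  obtain ⟨l, hl, hlast⟩ := List.exists_isChain_cons_of_relationReflTransGen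
    (hR ((a :: w).getLast (by simp)) a)
  have hsplit := List.dropLast_append_getLast (List.cons_ne_nil a w)
  have heq : a :: w ++ l = (a :: w).dropLast ++ (a :: w).getLast (by simp) :: l := by
    conv_lhs => rw [← hsplit]
    simp
  refine ⟨l, ?_, by simp, ?_⟩
  · rw [heq, List.isChain_split]
    exact ⟨by rwa [hsplit], hl⟩
  · rw [heq, List.getLast?_append, List.getLast?_eq_some_getLast (List.cons_ne_nil _ l), hlast]
    rfl

theorem primitive_loopSubst [Fintype B] (hR : ∀ a b, Relation.ReflTransGen R a b) :
    Primitive (loopSubst R) := by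
  have h : ∀ c : B × B, ∃ k, ∃ v ∈ realPow (loopSubst R) k [c.2], c.1 ∈ v := by
    rintro ⟨a, b⟩
    obtain ⟨l, hl, hlast⟩ := List.exists_isChain_cons_of_relationReflTransGen (hR b a)
    obtain ⟨v, hv⟩ := exists_isLoop_of_isChain hR hl
    obtain ⟨k, hk⟩ := hv.exists_mem_realPow
    exact ⟨k, _, hk, List.mem_append_left _ (hlast ▸ List.getLast_mem _)⟩
  choose k hk using h
  refine ⟨Finset.univ.sup k, fun a b => ?_⟩
  obtain ⟨v, hv, ha⟩ := hk (a, b)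
  exact ⟨v, realPow_mono singleton_mem_loopSubst (Finset.le_sup (Finset.mem_univ _)) _ hv, ha⟩

theorem legal_loopSubst_iff [Fintype B] [Nonempty B] (hR : ∀ a b, Relation.ReflTransGen R a b)
    {w : List B} : Legal (loopSubst R) w ↔ w.IsChain R := by
  constructor
  · rintro ⟨k, a, v, hv, hw⟩
    exact (realPow_loopSubst (.singleton a) hv).infix hw
  · intro hw
    cases w with
    | nil => exact ⟨0, Classical.arbitrary B, _, rfl, List.nil_infix⟩
    | cons a w =>
      obtain ⟨v, hv⟩ := exists_isLoop_of_isChain hR hw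
      obtain ⟨k, hk⟩ := hv.exists_mem_realPow
      exact ⟨k, a, _, hk, (List.prefix_append _ _).isInfix⟩

theorem mem_X_loopSubst_iff [Fintype B] (hR : ∀ a b, Relation.ReflTransGen R a b)
    {z : ℤ → B} : z ∈ X (loopSubst R) ↔ ∀ i, R (z i) (z (i + 1)) := by
  have : Nonempty B := ⟨z 0⟩
  constructor
  · intro hz i
    simpa [subwordAt, List.ofFn_succ] using (legal_loopSubst_iff hR).1 (hz i 2)
  · intro hz i n
    rw [legal_loopSubst_iff hR, subwordAt, List.isChain_ofFn]
    intro j hj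
    simpa [add_assoc] using hz (i + j)

end Loops

section Blocks

variable {A : Type*}

/-- The window of length `N` of `x` at position `i`. -/
def window (N : ℕ) (x : ℤ → A) (i : ℤ) : Fin N → A := fun j => x (i + (j : ℤ))

/-- The windows of length `N` of the points of `Y`. -/
def blocks (Y : Set (ℤ → A)) (N : ℕ) : Set (Fin N → A) :=
  {u | ∃ x ∈ Y, ∃ i, window N x i = u}

/-- The block `v` overlaps progressively with the block `u`. -/
def Overlap {N : ℕ} (u v : Fin N → A) : Prop :=
  ∀ j k : Fin N, (k : ℕ) = j + 1 → u k = v j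

theorem overlap_window (N : ℕ) (x : ℤ → A) (i : ℤ) :
    Overlap (window N x i) (window N x (i + 1)) := by
  intro j k h
  simp only [window, h]
  congr 1
  push_cast
  ring

theorem window_of_overlap {N : ℕ} {z : ℤ → Fin (N + 1) → A}
    (hz : ∀ i, Overlap (z i) (z (i + 1))) (i : ℤ) :
    window (N + 1) (fun i => z i 0) i = z i := by
  have h : ∀ (j : ℕ) (hj : j < N + 1) (i : ℤ), z (i + j) 0 = z i ⟨j, hj⟩ := by
    intro j
    induction j with
    | zero => intro hj i; simp
    | succ j ih =>
      intro hj i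
      rw [hz i ⟨j, by omega⟩ ⟨j + 1, hj⟩ rfl, ← ih]
      congr 1
      push_cast
      ring_nf
  funext j
  exact h j j.2 i

theorem subwordAt_eq_of_window_eq {N n : ℕ} (hn : n ≤ N) {x y : ℤ → A} {i j : ℤ}
    (h : window N x i = window N y j) : subwordAt x i n = subwordAt y j n := by
  unfold subwordAt
  congr 1
  funext k
  exact congrFun h ⟨k, k.2.trans_le hn⟩

theorem mem_of_window_mem_blocks {F : Set (List A)} {N : ℕ} (hF : ∀ u ∈ F, u.length ≤ N)
    {x : ℤ → A} (hx : ∀ i, window N x i ∈ blocks {x | ∀ u ∈ F, ¬ occursIn u x} N) :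
    x ∈ {x | ∀ u ∈ F, ¬ occursIn u x} := by
  rintro u hu ⟨i, hi⟩
  obtain ⟨y, hy, j, hj⟩ := hx i
  exact hy u hu ⟨j, hi.trans (subwordAt_eq_of_window_eq (hF u hu) hj.symm)⟩

theorem translate_mem {F : Set (List A)} {x : ℤ → A}
    (hx : x ∈ {x | ∀ u ∈ F, ¬ occursIn u x}) (c : ℤ) :
    (fun i => x (i + c)) ∈ {x | ∀ u ∈ F, ¬ occursIn u x} := by
  rintro u hu ⟨i, hi⟩
  refine hx u hu ⟨i + c, hi.trans ?_⟩
  unfold subwordAt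
  congr 1
  funext j
  ring_nf

theorem shift_iterate (x : ℤ → A) (m : ℕ) (i : ℤ) : shift^[m] x i = x (i + m) := by
  induction m generalizing x with
  | zero => simp
  | succ m ih =>
    rw [Function.iterate_succ_apply, ih, shift]
    congr 1
    push_cast
    ring

theorem isOpen_window_eq [TopologicalSpace A] [DiscreteTopology A] {N : ℕ} (u : Fin N → A) :
    IsOpen {x : ℤ → A | window N x 0 = u} := by
  have : Continuous fun x : ℤ → A => window N x 0 :=
    continuous_pi fun j => continuous_apply _
  exact (isOpen_discrete {u}).preimage this

end Blocks

end RS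

/-- Every nonempty topologically transitive shift of finite type is
topologically conjugate to the RS-subshift of a primitive random substitution on some
finite alphabet. -/
theorem stmt10 {A : Type*} [Fintype A] [TopologicalSpace A] [DiscreteTopology A]
    (Y : Set (ℤ → A)) (hne : Y.Nonempty)
    (hsft : ∃ F : Set (List A), F.Finite ∧ (∀ u ∈ F, u ≠ []) ∧
      Y = {x | ∀ u ∈ F, ¬ occursIn u x})
    (htrans : ∀ U V : Set (ℤ → A), IsOpen U → IsOpen V →
      (U ∩ Y).Nonempty → (V ∩ Y).Nonempty →
      ∃ m : ℕ, 1 ≤ m ∧ ∃ x ∈ Y, x ∈ V ∧ RS.shift^[m] x ∈ U) :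
    ∃ (n : ℕ) (θ : Fin n → Set (List (Fin n))),
      RS.IsRandomSubst θ ∧ RS.Primitive θ ∧
      ∃ h : (RS.X θ) ≃ₜ Y,
        ∀ (x : ℤ → Fin n) (hx : x ∈ RS.X θ),
          ∃ hx' : RS.shift x ∈ RS.X θ,
            ((h ⟨RS.shift x, hx'⟩ : Y) : ℤ → A) = RS.shift ((h ⟨x, hx⟩ : Y) : ℤ → A) := by
  classical
  obtain ⟨F, hFfin, -, rfl⟩ := hsft
  set Y : Set (ℤ → A) := {x | ∀ u ∈ F, ¬ occursIn u x}
  obtain ⟨N, hN⟩ := (hFfin.image List.length).bddAbove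
  have hF : ∀ u ∈ F, u.length ≤ N + 1 := fun u hu => (hN ⟨u, hu, rfl⟩).trans N.le_succ
  let e : RS.blocks Y (N + 1) ≃ Fin (Fintype.card (RS.blocks Y (N + 1))) := Fintype.equivFin _
  let R : Fin (Fintype.card (RS.blocks Y (N + 1))) → Fin (Fintype.card (RS.blocks Y (N + 1))) →
    Prop := fun a b => RS.Overlap (e.symm a).1 (e.symm b).1
  have htranslate : ∀ u ∈ RS.blocks Y (N + 1), ∃ x ∈ Y, RS.window (N + 1) x 0 = u := by
    rintro _ ⟨x, hx, i, rfl⟩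
    refine ⟨_, RS.translate_mem hx i, ?_⟩
    funext j
    simp [RS.window, add_comm]
  have hR : ∀ a b, Relation.ReflTransGen R a b := by
    intro a b
    obtain ⟨y, hy, hya⟩ := htranslate _ (e.symm a).2
    obtain ⟨y', hy', hyb⟩ := htranslate _ (e.symm b).2
    obtain ⟨m, -, x, hx, hxa, hxb⟩ := htrans _ _ (RS.isOpen_window_eq (e.symm b).1)
      (RS.isOpen_window_eq (e.symm a).1) ⟨y', hyb, hy'⟩ ⟨y, hya, hy⟩
    have hpath : ∀ k : ℕ, Relation.ReflTransGen R (e ⟨RS.window (N + 1) x 0, x, hx, 0, rfl⟩)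
        (e ⟨RS.window (N + 1) x k, x, hx, k, rfl⟩) := by
      intro k
      induction k with
      | zero => exact .refl
      | succ k ih =>
        refine ih.tail ?_
        simpa [R] using RS.overlap_window (N + 1) x k
    convert hpath m
    · exact (e.symm_apply_eq.1 (Subtype.ext hxa.symm))
    · refine (e.symm_apply_eq.1 (Subtype.ext ?_))
      rw [← hxb]
      funext j
      simp [RS.window, RS.shift_iterate, add_comm]
  have hX {z} : z ∈ RS.X (RS.loopSubst R) ↔ ∀ i, R (z i) (z (i + 1)) :=
    RS.mem_X_loopSubst_iff hR
  have hwin {z} (hz : z ∈ RS.X (RS.loopSubst R)) (i : ℤ) :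
      RS.window (N + 1) (fun i => (e.symm (z i)).1 0) i = (e.symm (z i)).1 :=
    RS.window_of_overlap (z := fun i => (e.symm (z i)).1) (hX.1 hz) i
  let h : RS.X (RS.loopSubst R) ≃ₜ Y :=
    { toFun := fun z => ⟨fun i => (e.symm (z.1 i)).1 0, RS.mem_of_window_mem_blocks hF fun i => by
        rw [hwin z.2 i]
        exact (e.symm (z.1 i)).2⟩
      invFun := fun y => ⟨fun i => e ⟨RS.window (N + 1) y.1 i, y.1, y.2, i, rfl⟩, hX.2 fun i => by
        simpa [R] using RS.overlap_window (N + 1) y.1 i⟩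
      left_inv := fun z => by
        ext1
        funext i
        exact e.symm_apply_eq.1 (Subtype.ext (hwin z.2 i).symm) |>.symm
      right_inv := fun y => by
        ext1
        funext i
        simp [RS.window]
      continuous_toFun := by
        refine Continuous.subtype_mk (continuous_pi fun i => ?_) _
        exact (continuous_of_discreteTopology (f := fun a => (e.symm a).1 0)).comp
          ((continuous_apply i).comp continuous_subtype_val)
      continuous_invFun := by
        refine Continuous.subtype_mk (continuous_pi fun i => ?_) _
        refine (continuous_of_discreteTopology (f := e)).comp (Continuous.subtype_mk ?_ _)
        exact continuous_pi fun j => (continuous_apply _).comp continuous_subtype_val }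
  exact ⟨_, RS.loopSubst R, RS.isRandomSubst_loopSubst, RS.primitive_loopSubst hR, h,
    fun x hx => ⟨hX.2 fun i => hX.1 hx (i + 1), rfl⟩⟩
end

section
/- Let θ be a primitive random substitution on a finite alphabet 𝒜 with nonempty RS-subshift X_θ, and let m ≥ 2 be an integer. Then there exists a primitive random substitution θ̂ (on the alphabet 𝒜 × {1,…,m}) and a factor map f : X_{θ̂} → X_θ such that h_{θ̂} = h_θ + log m. -/
namespace RS

section Decorate

variable {A : Type*} {I : Type*}

/-- The random substitution on `A × I` whose realisations are all decorations by `I` of the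
realisations of `θ`. -/
def decorate (I : Type*) {A : Type*} (θ : A → Set (List A)) (p : A × I) : Set (List (A × I)) :=
  {u | u.map Prod.fst ∈ θ p.1}

theorem map_fst_map_mk (i : I) (w : List A) : (w.map fun a => (a, i)).map Prod.fst = w := by
  simp [Function.comp_def]

theorem eq_of_map_fst_of_map_snd {u v : List (A × I)} (h₁ : u.map Prod.fst = v.map Prod.fst)
    (h₂ : u.map Prod.snd = v.map Prod.snd) : u = v := by
  rw [List.zip_of_prod (l := u.map Prod.fst) (l' := u.map Prod.snd) rfl rfl, h₁, h₂]
  exact (List.zip_of_prod rfl rfl).symm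

theorem mem_real_decorate (θ : A → Set (List A)) (w u : List (A × I)) :
    u ∈ real (decorate I θ) w ↔ u.map Prod.fst ∈ real θ (w.map Prod.fst) := by
  induction w generalizing u with
  | nil => simp [real]
  | cons p w ih =>
    simp only [real, List.map_cons, Set.mem_ofPred_eq]
    constructor
    · rintro ⟨v, hv, r, hr, rfl⟩
      exact ⟨_, hv, _, (ih r).1 hr, by simp⟩
    · rintro ⟨v, hv, r, hr, h⟩
      obtain ⟨v', r', rfl, rfl, rfl⟩ := List.map_eq_append_iff.1 h
      exact ⟨v', hv, r', (ih r').2 hr, rfl⟩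

theorem mem_realPow_decorate [Nonempty I] (θ : A → Set (List A)) (k : ℕ) (w u : List (A × I)) :
    u ∈ realPow (decorate I θ) (k + 1) w ↔
      u.map Prod.fst ∈ realPow θ (k + 1) (w.map Prod.fst) := by
  induction k generalizing w with
  | zero => simp [realPow, mem_real_decorate]
  | succ k ih =>
    rw [realPow, realPow]
    simp only [Set.mem_iUnion, exists_prop, ih, mem_real_decorate]
    constructor
    · rintro ⟨v, hv, h⟩
      exact ⟨_, hv, h⟩
    · rintro ⟨v, hv, h⟩
      let i : I := Classical.arbitrary I
      exact ⟨v.map fun a => (a, i), by rwa [map_fst_map_mk], by rwa [map_fst_map_mk]⟩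

theorem map_fst_mem_realPow [Nonempty I] (θ : A → Set (List A)) (k : ℕ) {w u : List (A × I)}
    (h : u ∈ realPow (decorate I θ) k w) : u.map Prod.fst ∈ realPow θ k (w.map Prod.fst) := by
  cases k with
  | zero => simp only [realPow, Set.mem_singleton_iff] at h ⊢; rw [h]
  | succ k => exact (mem_realPow_decorate θ k w u).1 h

theorem legal_decorate [Nonempty I] (θ : A → Set (List A)) (u : List (A × I)) :
    Legal (decorate I θ) u ↔ Legal θ (u.map Prod.fst) := by
  let i : I := Classical.arbitrary I
  constructor
  · rintro ⟨k, a, v, hv, h⟩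
    exact ⟨k, a.1, _, map_fst_mem_realPow θ k hv, h.map _⟩
  · rintro ⟨k, a, v, hv, s, t, h⟩
    cases k with
    | zero =>
      simp only [realPow, Set.mem_singleton_iff] at hv
      have hlen : u.length ≤ 1 := by
        have := congrArg List.length (h.trans hv)
        simp at this
        omega
      match u, hlen with
      | [], _ => exact ⟨0, (a, i), [(a, i)], rfl, List.nil_infix⟩
      | [p], _ => exact ⟨0, p, [p], rfl, List.infix_rfl⟩
    | succ k =>
      refine ⟨k + 1, (a, i), s.map (fun a => (a, i)) ++ u ++ t.map (fun a => (a, i)), ?_,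
        _, _, rfl⟩
      rw [mem_realPow_decorate, List.map_append, List.map_append, map_fst_map_mk,
        map_fst_map_mk, h]
      exact hv

theorem map_subwordAt {B : Type*} (g : A → B) (x : ℤ → A) (i : ℤ) (n : ℕ) :
    (subwordAt x i n).map g = subwordAt (g ∘ x) i n := by
  simp [subwordAt, List.map_ofFn, Function.comp_def]

theorem mem_X_decorate [Nonempty I] (θ : A → Set (List A)) (x : ℤ → A × I) :
    x ∈ X (decorate I θ) ↔ Prod.fst ∘ x ∈ X θ := by
  simp only [X, Set.mem_ofPred_eq, legal_decorate, map_subwordAt]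

theorem isRandomSubst_decorate [Nonempty I] [Finite I] {θ : A → Set (List A)}
    (hθ : IsRandomSubst θ) : IsRandomSubst (decorate I θ) := by
  let i : I := Classical.arbitrary I
  rintro ⟨a, j⟩
  obtain ⟨⟨v, hv⟩, hfin, hnil⟩ := hθ a
  refine ⟨⟨v.map fun a => (a, i), ?_⟩, ?_, ?_⟩
  · simpa only [decorate, Set.mem_ofPred_eq, map_fst_map_mk] using hv
  · refine Set.Finite.preimage' hfin fun w _ => ?_
    refine Set.Finite.of_finite_image (f := List.map Prod.snd)
      ((List.finite_length_eq I w.length).subset ?_) ?_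
    · rintro _ ⟨u, hu, rfl⟩
      simp only [Set.mem_preimage, Set.mem_singleton_iff] at hu
      simp [← hu]
    · intro u hu u' hu' h
      simp only [Set.mem_preimage, Set.mem_singleton_iff] at hu hu'
      exact eq_of_map_fst_of_map_snd (hu.trans hu'.symm) h
  · rintro u hu rfl
    exact hnil _ hu rfl

theorem exists_pos_of_primitive {θ : A → Set (List A)} (hθ : IsRandomSubst θ)
    (hp : Primitive θ) : ∃ k : ℕ, ∀ a b : A, ∃ v ∈ realPow θ (k + 1) [b], a ∈ v := by
  obtain ⟨k, hk⟩ := hp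
  cases k with
  | succ k => exact ⟨k, hk⟩
  | zero =>
    refine ⟨0, fun a b => ?_⟩
    have heq : ∀ a b : A, a = b := fun a b => by simpa [realPow] using hk a b
    obtain ⟨⟨v, hv⟩, -, hnil⟩ := hθ b
    refine ⟨v, by simpa [realPow, real] using hv, ?_⟩
    obtain ⟨c, hc⟩ := List.exists_mem_of_ne_nil v (hnil v hv)
    rwa [heq a c]

theorem primitive_decorate [Nonempty I] {θ : A → Set (List A)} (hθ : IsRandomSubst θ)
    (hp : Primitive θ) : Primitive (decorate I θ) := by
  obtain ⟨k, hk⟩ := exists_pos_of_primitive hθ hp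
  refine ⟨k + 1, fun ⟨a, i⟩ ⟨b, j⟩ => ?_⟩
  obtain ⟨v, hv, ha⟩ := hk a b
  refine ⟨v.map fun a => (a, i), ?_, List.mem_map.2 ⟨a, ha, rfl⟩⟩
  rw [mem_realPow_decorate, map_fst_map_mk]
  exact hv

theorem mem_lang_decorate [Nonempty I] (θ : A → Set (List A)) (n : ℕ) (u : List (A × I)) :
    u ∈ lang (X (decorate I θ)) n ↔ u.map Prod.fst ∈ lang (X θ) n := by
  let j₀ : I := Classical.arbitrary I
  constructor
  · rintro ⟨hl, x, hx, i, rfl⟩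
    exact ⟨by simpa using hl, _, (mem_X_decorate θ x).1 hx, i, map_subwordAt _ _ _ _⟩
  · rintro ⟨hl, y, hy, i, h⟩
    have hl' : u.length = n := by simpa using hl
    refine ⟨hl', fun j => (y j, ((u.map Prod.snd)[(j - i).toNat]?).getD j₀),
      (mem_X_decorate θ _).2 hy, i, ?_⟩
    refine List.ext_getElem (by simp [subwordAt, hl']) fun t h₁ h₂ => ?_
    have hfst : (u.map Prod.fst)[t]'(by simpa using h₁) = y (i + t) := by
      simp [h, subwordAt]
    rw [List.getElem_map] at hfst
    ext
    · simp [subwordAt, hfst]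
    · simp [subwordAt, h₁]

theorem ncard_length_eq (I : Type*) [Finite I] (n : ℕ) :
    {l : List I | l.length = n}.ncard = Nat.card I ^ n := by
  have := Fintype.ofFinite I
  rw [Nat.card_eq_fintype_card, ← card_vector, ← Nat.card_eq_fintype_card]
  rfl

theorem ncard_lang_decorate [Nonempty I] [Finite I] (θ : A → Set (List A)) (n : ℕ) :
    (lang (X (decorate I θ)) n).ncard = (lang (X θ) n).ncard * Nat.card I ^ n := by
  rw [← ncard_length_eq, ← Set.ncard_prod]
  refine Set.ncard_congr (fun u _ => (u.map Prod.fst, u.map Prod.snd)) ?_ ?_ ?_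
  · intro u hu
    exact ⟨(mem_lang_decorate θ n u).1 hu, by simpa using hu.1⟩
  · intro u v _ _ h
    exact eq_of_map_fst_of_map_snd (congrArg Prod.fst h) (congrArg Prod.snd h)
  · rintro ⟨v, w⟩ ⟨hv, hw⟩
    have hvw : v.length = w.length := hv.1.trans hw.symm
    have h₁ : (v.zip w).map Prod.fst = v := List.map_fst_zip hvw.le
    have h₂ : (v.zip w).map Prod.snd = w := List.map_snd_zip hvw.ge
    exact ⟨v.zip w, (mem_lang_decorate θ n _).2 (by rwa [h₁]), by rw [h₁, h₂]⟩

theorem lang_finite [Finite A] (Y : Set (ℤ → A)) (n : ℕ) : (lang Y n).Finite :=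
  (List.finite_length_eq A n).subset fun _ hu => hu.1

theorem ncard_lang_pos [Finite A] {Y : Set (ℤ → A)} (hY : Y.Nonempty) (n : ℕ) :
    0 < (lang Y n).ncard := by
  obtain ⟨x, hx⟩ := hY
  exact (Set.ncard_pos (lang_finite Y n)).2 ⟨subwordAt x 0 n, by simp [subwordAt], x, hx, 0, rfl⟩

theorem log_ncard_lang_div_le [Finite A] {Y : Set (ℤ → A)} (hY : Y.Nonempty) (n : ℕ) :
    Real.log (lang Y n).ncard / n ≤ Real.log (Nat.card A) := by
  have : Nonempty A := ⟨hY.some 0⟩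
  have hle : (lang Y n).ncard ≤ Nat.card A ^ n := by
    rw [← ncard_length_eq]
    exact Set.ncard_le_ncard (fun _ hu => hu.1) (List.finite_length_eq A n)
  refine div_le_of_le_mul₀ n.cast_nonneg (Real.log_natCast_nonneg _) ?_
  rw [mul_comm, ← Real.log_pow]
  exact Real.log_le_log (by exact_mod_cast ncard_lang_pos hY n) (by exact_mod_cast hle)

theorem entropy_decorate [Finite A] [Nonempty I] [Finite I] {θ : A → Set (List A)}
    (hne : (X θ).Nonempty) :
    entropy (X (decorate I θ)) = entropy (X θ) + Real.log (Nat.card I) := by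
  rw [entropy, entropy, ← limsup_add_const]
  · refine Filter.limsup_congr ?_
    filter_upwards [Filter.eventually_gt_atTop 0] with n hn
    have hn' : (n : ℝ) ≠ 0 := by exact_mod_cast hn.ne'
    have hp : ((lang (X θ) n).ncard : ℝ) ≠ 0 := by exact_mod_cast (ncard_lang_pos hne n).ne'
    have hc : (Nat.card I : ℝ) ≠ 0 := by exact_mod_cast Nat.card_pos.ne'
    rw [ncard_lang_decorate, Nat.cast_mul, Nat.cast_pow, Real.log_mul hp (pow_ne_zero _ hc),
      Real.log_pow]
    field_simp
  · exact Filter.isBoundedUnder_of ⟨_, log_ncard_lang_div_le hne⟩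
  · exact Filter.IsBoundedUnder.isCoboundedUnder_le (Filter.isBoundedUnder_of
      ⟨0, fun n => div_nonneg (Real.log_natCast_nonneg _) n.cast_nonneg⟩)

theorem exists_isFactorMap_decorate [Nonempty I] [TopologicalSpace A] [TopologicalSpace I]
    (θ : A → Set (List A)) :
    ∃ f : X (decorate I θ) → X θ, IsFactorMap (X (decorate I θ)) (X θ) f := by
  refine ⟨fun x => ⟨Prod.fst ∘ x.1, (mem_X_decorate θ x.1).1 x.2⟩, ?_, ?_, fun _ _ _ => rfl⟩
  · refine Continuous.subtype_mk (continuous_pi fun i => ?_) _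
    exact continuous_fst.comp ((continuous_apply i).comp continuous_subtype_val)
  · rintro ⟨y, hy⟩
    exact ⟨⟨fun i => (y i, Classical.arbitrary I), (mem_X_decorate θ _).2 hy⟩, rfl⟩

end Decorate

end RS

/-- For every primitive random substitution `θ` with nonempty RS-subshift and
every integer `m ≥ 2`, there is a primitive random substitution on the alphabet `A × Fin m`
whose RS-subshift factors onto `X θ` and has entropy `h θ + log m`. -/
theorem stmt12 {A : Type*} [Fintype A] [TopologicalSpace A] [DiscreteTopology A]
    (θ : A → Set (List A)) (hrs : RS.IsRandomSubst θ) (hprim : RS.Primitive θ)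
    (hne : (RS.X θ).Nonempty) (m : ℕ) (hm : 2 ≤ m) :
    ∃ θ' : A × Fin m → Set (List (A × Fin m)),
      RS.IsRandomSubst θ' ∧ RS.Primitive θ' ∧
      (∃ f : (RS.X θ') → (RS.X θ), RS.IsFactorMap (RS.X θ') (RS.X θ) f) ∧
      RS.entropy (RS.X θ') = RS.entropy (RS.X θ) + Real.log m := by
  have : Nonempty (Fin m) := ⟨⟨0, by omega⟩⟩
  refine ⟨RS.decorate (Fin m) θ, RS.isRandomSubst_decorate hrs, RS.primitive_decorate hrs hprim,
    RS.exists_isFactorMap_decorate θ, ?_⟩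
  rw [RS.entropy_decorate hne, Nat.card_fin]
end

section
/- Let 1 ≤ k ≤ K be integers and let X ⊆ {0,1}^ℤ be the subshift of all x such that the set {i ∈ ℤ : x_i = 1} is unbounded above and below and, whenever i < j satisfy x_i = x_j = 1 and x_l = 0 for all i < l < j, one has k ≤ j − i ≤ K. Then for every N ≥ 1 the complexity function satisfies p_X(N) ≤ K² (K − k + 1)^{⌊(N−1)/k⌋}. -/
/-- The subshift of `{0,1}^ℤ` consisting of sequences with infinitely many `1`s in both
directions and in which any two consecutive occurrences of `1` are at distance at least `k`
and at most `K`. -/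
def gapSet (k K : ℕ) : Set (ℤ → Fin 2) :=
  {x | (∀ m : ℤ, ∃ i : ℤ, m < i ∧ x i = 1) ∧ (∀ m : ℤ, ∃ i : ℤ, i < m ∧ x i = 1) ∧
    ∀ i j : ℤ, i < j → x i = 1 → x j = 1 → (∀ l : ℤ, i < l → l < j → x l = 0) →
      (k : ℤ) ≤ j - i ∧ j - i ≤ (K : ℤ)}

/-- Every position of a point of `gapSet k K` is followed by a `1` at distance at most `K`. -/
theorem exists_next_one {k K : ℕ} {x : ℤ → Fin 2} (hx : x ∈ gapSet k K) (t : ℤ) :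
    ∃ r : ℕ, 1 ≤ r ∧ r ≤ K ∧ x (t + r) = 1 ∧ (∀ l, t < l → l < t + r → x l ≠ 1) ∧
      (x t = 1 → k ≤ r) := by
  obtain ⟨hright, hleft, hgap⟩ := hx
  obtain ⟨b, ⟨hb, hxb⟩, hbmin⟩ := Int.exists_least_of_bdd (P := fun j => t < j ∧ x j = 1)
    ⟨t, fun z hz => hz.1.le⟩ (hright t)
  obtain ⟨a, ⟨ha, hxa⟩, hamax⟩ := Int.exists_greatest_of_bdd (P := fun j => j < t + 1 ∧ x j = 1)
    ⟨t + 1, fun z hz => hz.1.le⟩ (hleft (t + 1))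
  have hab : ∀ l, a < l → l < b → x l ≠ 1 := fun l hal hlb hl => by
    rcases lt_or_ge t l with htl | hlt
    · have := hbmin l ⟨htl, hl⟩
      omega
    · have := hamax l ⟨by omega, hl⟩
      omega
  obtain ⟨hk, hK⟩ := hgap a b (by omega) hxa hxb fun l hal hlb => by
    have := hab l hal hlb
    omega
  have hbt : t + ((b - t).toNat : ℤ) = b := by omega
  refine ⟨(b - t).toNat, by omega, by omega, by rwa [hbt], ?_, fun hxt => ?_⟩
  · rw [hbt]
    exact fun l htl hlb => hab l (by omega) hlb
  · have := hamax t ⟨by omega, hxt⟩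
    omega

/-- The positions of the `1`s of a point of `gapSet k K` from `i` on, listed in terms of the
offset of the first one and the successive gaps. -/
theorem exists_gaps {k K : ℕ} {x : ℤ → Fin 2} (hx : x ∈ gapSet k K) (i : ℤ) :
    ∃ (p : ℕ) (g : ℕ → ℕ), p < K ∧ (∀ n, k ≤ g n ∧ g n ≤ K ∧ 1 ≤ g n) ∧
      ∀ j : ℕ, x (i + j) = 1 ↔ ∃ m, j = p + ∑ t ∈ Finset.range m, g t := by
  choose r hr1 hrK hxr hrmin hrk using fun t => exists_next_one hx t
  let s : ℕ → ℤ := fun n => (fun t => t + (r t : ℤ))^[n] (i - 1 + r (i - 1))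
  have hs_succ : ∀ n, s (n + 1) = s n + r (s n) := fun n => Function.iterate_succ_apply' _ _ _
  have hs_one : ∀ n, x (s n) = 1 := by
    intro n
    cases n with
    | zero => exact hxr _
    | succ n => rw [hs_succ]; exact hxr _
  have hs_sum : ∀ m, s m = i + ((r (i - 1) - 1 + ∑ t ∈ Finset.range m, r (s t) : ℕ) : ℤ) := by
    intro m
    induction m with
    | zero =>
      have h : s 0 = i - 1 + r (i - 1) := rfl
      have := hr1 (i - 1)
      rw [h, Finset.sum_range_zero]
      omega
    | succ m ih =>
      rw [hs_succ, Finset.sum_range_succ]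
      push_cast at ih ⊢
      linarith
  have hs_cover : ∀ n, ∀ t, i ≤ t → t ≤ s n → x t = 1 → ∃ m, t = s m := by
    intro n
    induction n with
    | zero =>
      intro t hit hts hxt
      by_contra! hne
      exact hrmin (i - 1) t (by omega) (lt_of_le_of_ne hts (hne 0)) hxt
    | succ n ih =>
      intro t hit hts hxt
      rcases le_or_gt t (s n) with h | h
      · exact ih t hit h hxt
      · by_contra! hne
        exact hrmin (s n) t h (hs_succ n ▸ lt_of_le_of_ne hts (hne _)) hxt
  have hs_ge : ∀ n : ℕ, i + n ≤ s n := by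
    intro n
    induction n with
    | zero =>
      rw [hs_sum]
      omega
    | succ n ih =>
      have := hr1 (s n)
      rw [hs_succ]
      push_cast
      omega
  refine ⟨r (i - 1) - 1, fun n => r (s n), ?_, fun n => ⟨hrk _ (hs_one n), hrK _, hr1 _⟩,
    fun j => ⟨fun hj => ?_, ?_⟩⟩
  · have := hr1 (i - 1)
    have := hrK (i - 1)
    omega
  · obtain ⟨m, hm⟩ := hs_cover j (i + j) (by omega) (hs_ge j) hj
    refine ⟨m, ?_⟩
    rw [hs_sum] at hm
    exact_mod_cast add_left_cancel hm
  · rintro ⟨m, rfl⟩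
    rw [← hs_sum]
    exact hs_one m

open Classical in
/-- The word of length `N` whose `1`s sit at `p` and at the positions reached from `p` by
successive gaps `k + g 0, k + g 1, …`. -/
noncomputable def wordOfGaps (k N : ℕ) {K M L : ℕ} (c : Fin K × (Fin M → Fin L)) :
    List (Fin 2) :=
  List.ofFn fun j : Fin N =>
    if ∃ m ≤ M, (j : ℕ) =
        c.1 + ∑ t ∈ Finset.range m, (if h : t < M then k + (c.2 ⟨t, h⟩ : ℕ) else 0)
    then 1 else 0

/-- A word of length `N` of `gapSet k K` is determined by the offset of its first `1` and
`(N - 1) / k` successive gaps. -/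
theorem lang_gapSet_subset_range {k K : ℕ} (hk : 1 ≤ k) (N : ℕ) :
    RS.lang (gapSet k K) N ⊆
      Set.range (wordOfGaps k N (K := K) (M := (N - 1) / k) (L := K - k + 1)) := by
  rintro u ⟨-, x, hx, i, rfl⟩
  obtain ⟨p, g, hp, hg, hone⟩ := exists_gaps hx i
  refine ⟨⟨⟨p, hp⟩, fun t => ⟨g t - k, by have := hg t; omega⟩⟩, ?_⟩
  unfold wordOfGaps RS.subwordAt
  congr 1
  funext j
  have hsum : ∀ m ≤ (N - 1) / k, ∑ t ∈ Finset.range m,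
      (if t < (N - 1) / k then k + (g t - k) else 0) = ∑ t ∈ Finset.range m, g t := by
    intro m hm
    refine Finset.sum_congr rfl fun t ht => ?_
    have := Finset.mem_range.1 ht
    have := (hg t).1
    rw [if_pos (by omega)]
    omega
  have hiff : (∃ m ≤ (N - 1) / k, (j : ℕ) = p + ∑ t ∈ Finset.range m,
      (if t < (N - 1) / k then k + (g t - k) else 0)) ↔ x (i + (j : ℕ)) = 1 := by
    rw [hone]
    constructor
    · rintro ⟨m, hm, h⟩
      exact ⟨m, by rw [h, hsum m hm]⟩
    · rintro ⟨m, h⟩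
      have hm : m ≤ (N - 1) / k := by
        rw [Nat.le_div_iff_mul_le hk]
        have : m * k ≤ ∑ t ∈ Finset.range m, g t := by
          simpa using Finset.card_nsmul_le_sum (Finset.range m) g k fun t _ => (hg t).1
        have := j.isLt
        omega
      exact ⟨m, hm, by rw [h, hsum m hm]⟩
  simp only [dite_eq_ite]
  split_ifs with h
  · exact (hiff.1 h).symm
  · have := mt hiff.2 h
    omega

/-- For `1 ≤ k ≤ K`, the complexity function of the subshift of `{0,1}^ℤ`
whose consecutive `1`s are at distance in `[k, K]` satisfies
`p(N) ≤ K² (K − k + 1)^⌊(N−1)/k⌋` for all `N ≥ 1`. -/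
theorem stmt13 (k K : ℕ) (hk : 1 ≤ k) (hkK : k ≤ K) (N : ℕ) (hN : 1 ≤ N) :
    (RS.lang (gapSet k K) N).ncard ≤ K ^ 2 * (K - k + 1) ^ ((N - 1) / k) := by
  calc (RS.lang (gapSet k K) N).ncard
      ≤ (Set.range (wordOfGaps k N (K := K) (M := (N - 1) / k) (L := K - k + 1))).ncard :=
        Set.ncard_le_ncard (lang_gapSet_subset_range hk N) (Set.finite_range _)
    _ ≤ Nat.card (Fin K × (Fin ((N - 1) / k) → Fin (K - k + 1))) := by
        rw [← Nat.card_coe_set_eq]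
        exact Finite.card_range_le _
    _ = K * (K - k + 1) ^ ((N - 1) / k) := by simp
    _ ≤ K ^ 2 * (K - k + 1) ^ ((N - 1) / k) :=
        Nat.mul_le_mul_right _ (Nat.le_self_pow two_ne_zero K)
end

section
/- Let k ≥ 2 be an integer and let θ be the random substitution on the three-letter alphabet {a, ā, b} given by θ(a) = θ(ā) = {b^k} and θ(b) = {b^{k−1}a, b^{k−1}ā}. Then θ is primitive, X_θ is nonempty, and the topological entropy satisfies h_θ ≤ (1/k) log 2. -/
namespace RS

section General

variable {A : Type*} {θ : A → Set (List A)}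

theorem real_nonempty (hθ : ∀ a, (θ a).Nonempty) (w : List A) : (real θ w).Nonempty := by
  induction w with
  | nil => exact ⟨[], rfl⟩
  | cons a w ih =>
    obtain ⟨v, hv⟩ := hθ a
    obtain ⟨r, hr⟩ := ih
    exact ⟨v ++ r, v, hv, r, hr, rfl⟩

theorem realPow_nonempty (hθ : ∀ a, (θ a).Nonempty) (m : ℕ) (w : List A) :
    (realPow θ m w).Nonempty := by
  induction m generalizing w with
  | zero => exact ⟨w, rfl⟩
  | succ m ih =>
    obtain ⟨v, hv⟩ := real_nonempty hθ w
    obtain ⟨u, hu⟩ := ih v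
    exact ⟨u, Set.mem_biUnion hv hu⟩

theorem length_of_mem_real {k : ℕ} (hθ : ∀ a, ∀ u ∈ θ a, u.length = k) {w v : List A}
    (hv : v ∈ real θ w) : v.length = k * w.length := by
  induction w generalizing v with
  | nil => simp [show v = [] from hv]
  | cons a w ih =>
    obtain ⟨u, hu, r, hr, rfl⟩ := hv
    rw [List.length_append, ih hr, hθ a u hu, List.length_cons]
    ring

theorem length_of_mem_realPow {k : ℕ} (hθ : ∀ a, ∀ u ∈ θ a, u.length = k) {m : ℕ}
    {w v : List A} (hv : v ∈ realPow θ m w) : v.length = k ^ m * w.length := by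
  induction m generalizing w with
  | zero => simp [show v = w from hv]
  | succ m ih =>
    obtain ⟨u, hu, hv⟩ := Set.mem_iUnion₂.1 hv
    rw [ih hv, length_of_mem_real hθ hu]
    ring

theorem Legal.of_subword {u v : List A} (hv : Legal θ v) (h : u <:+: v) : Legal θ u := by
  obtain ⟨k, a, w, hw, hvw⟩ := hv
  exact ⟨k, a, w, hw, h.trans hvw⟩

theorem subwordAt_subword (x : ℤ → A) {i i' : ℤ} {n n' : ℕ} (h : i' ≤ i)
    (h' : i + n ≤ i' + n') : subwordAt x i n <:+: subwordAt x i' n' := by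
  obtain ⟨d, rfl⟩ := Int.exists_add_of_le h
  obtain ⟨e, rfl⟩ : ∃ e, n' = d + n + e := ⟨n' - (d + n), by omega⟩
  refine ⟨subwordAt x i' d, subwordAt x (i' + d + n) e, ?_⟩
  refine List.ext_getElem (by simp [subwordAt, add_assoc]) fun m h₁ h₂ => ?_
  simp only [subwordAt, List.getElem_append, List.getElem_ofFn, List.length_append,
    List.length_ofFn] at h₁ ⊢
  split_ifs <;> congr 1 <;> omega

/-- If there are arbitrarily long legal words, compactness yields a point of the subshift. -/
theorem X_nonempty [Finite A] (h : ∀ n, ∃ u, Legal θ u ∧ n ≤ u.length) : (X θ).Nonempty := by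
  let _ : TopologicalSpace A := ⊥
  have : DiscreteTopology A := ⟨rfl⟩
  let S : ℕ → Set (ℤ → A) := fun N => {x | Legal θ (subwordAt x (-N) (2 * N))}
  have hclosed : ∀ N, IsClosed (S N) := fun N => by
    have hc : Continuous fun x : ℤ → A => fun j : Fin (2 * N) => x (-N + (j : ℤ)) := by
      fun_prop
    exact (isClosed_discrete {f : Fin (2 * N) → A | Legal θ (List.ofFn f)}).preimage hc
  have hanti : ∀ N, S (N + 1) ⊆ S N := fun N x hx =>
    Legal.of_subword hx (subwordAt_subword x (by push_cast; omega) (by push_cast; omega))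
  have hne : ∀ N, (S N).Nonempty := fun N => by
    obtain ⟨u, hu, hlen⟩ := h (2 * N)
    obtain ⟨a, -, -⟩ := hu.choose_spec
    refine ⟨fun i => u.getD (i + N).toNat a, hu.of_subword ?_⟩
    refine List.IsPrefix.isInfix (List.prefix_iff_eq_take.2 ?_)
    refine List.ext_getElem (by simp [subwordAt, hlen]) fun m h₁ h₂ => ?_
    have hm : m < 2 * N := by simpa [subwordAt] using h₁
    simp [subwordAt, List.getElem?_eq_getElem (hm.trans_le hlen)]
  obtain ⟨x, hx⟩ := IsCompact.nonempty_iInter_of_sequence_nonempty_isCompact_isClosed S hanti hne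
    (hclosed 0).isCompact hclosed
  refine ⟨x, fun i n => ?_⟩
  have hx' := Set.mem_iInter.1 hx (i.natAbs + n)
  exact Legal.of_subword hx' (subwordAt_subword x (by omega) (by omega))

end General

section Pattern

variable {k : ℕ}

/-- The exact power of `k` dividing `m` is even. -/
def EvenMult (k m : ℕ) : Prop := Even (multiplicity k m)

theorem evenMult_of_not_dvd {m : ℕ} (h : ¬ k ∣ m) : EvenMult k m := by
  simp [EvenMult, multiplicity_eq_zero.2 h]

theorem evenMult_mul_self (hk : 2 ≤ k) {m : ℕ} (hm : 0 < m) :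
    EvenMult k (k * m) ↔ ¬ EvenMult k m := by
  have hfin : ∀ {n : ℕ}, 0 < n → FiniteMultiplicity k n := fun hn =>
    Nat.finiteMultiplicity_iff.2 ⟨by omega, hn⟩
  have hmul : multiplicity k (k * m) = multiplicity k m + 1 := by
    obtain ⟨h₁, h₂⟩ := (hfin hm).multiplicity_eq_iff.1 rfl
    refine (hfin (by positivity)).multiplicity_eq_iff.2 ⟨?_, ?_⟩
    · rw [pow_succ']; exact mul_dvd_mul_left k h₁
    · rw [pow_succ']
      exact fun h => h₂ (Nat.dvd_of_mul_dvd_mul_left (by omega) h)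
  rw [EvenMult, EvenMult, hmul, Nat.even_add_one]

theorem evenMult_congr {L x y : ℕ} (hx : ¬ k ^ L ∣ x) (h : x ≡ y [MOD k ^ L]) :
    EvenMult k x ↔ EvenMult k y := by
  have hdvd : ∀ n, k ^ n ∣ x ↔ k ^ n ∣ y := fun n => by
    rcases le_total n L with hn | hn
    · exact (h.of_dvd (pow_dvd_pow k hn)).dvd_iff dvd_rfl
    · have hy : ¬ k ^ L ∣ y := fun hy => hx ((h.dvd_iff dvd_rfl).2 hy)
      exact iff_of_false (fun h' => hx ((pow_dvd_pow k hn).trans h'))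
        (fun h' => hy ((pow_dvd_pow k hn).trans h'))
  rw [EvenMult, EvenMult, multiplicity, multiplicity, emultiplicity_eq_emultiplicity_iff.2 hdvd]

/-- The positions of the letter `2` in `w`, numbered from `j`, are those at which `EvenMult k`
holds. -/
def HasPattern (k j : ℕ) (w : List (Fin 3)) : Prop :=
  ∀ (i : ℕ) (c : Fin 3), w[i]? = some c → (c = 2 ↔ EvenMult k (j + i))

theorem HasPattern.append {j : ℕ} {u v : List (Fin 3)} (hu : HasPattern k j u)
    (hv : HasPattern k (j + u.length) v) : HasPattern k j (u ++ v) := by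
  intro i c hc
  rcases lt_or_ge i u.length with hi | hi
  · exact hu i c (by rwa [List.getElem?_append_left hi] at hc)
  · rw [List.getElem?_append_right hi] at hc
    have := hv _ c hc
    rwa [add_assoc, Nat.add_sub_cancel' hi] at this

theorem HasPattern.tail {j : ℕ} {c : Fin 3} {w : List (Fin 3)} (h : HasPattern k j (c :: w)) :
    HasPattern k (j + 1) w := by
  intro i d hd
  have := h (i + 1) d (by simpa using hd)
  rwa [add_comm i, ← add_assoc] at this

theorem HasPattern.of_subword {j : ℕ} {u v : List (Fin 3)} (h : HasPattern k j v)
    (huv : u <:+: v) : ∃ d, HasPattern k (j + d) u := by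
  obtain ⟨s, t, rfl⟩ := huv
  refine ⟨s.length, fun i c hc => ?_⟩
  have hi : i < u.length := (List.getElem?_eq_some_iff.1 hc).1
  have := h (s.length + i) c (by
    rw [List.append_assoc, List.getElem?_append_right (by omega), Nat.add_sub_cancel_left,
      List.getElem?_append_left hi, hc])
  rwa [← add_assoc] at this

theorem hasPattern_replicate_append (hk : 2 ≤ k) (j : ℕ) {d : Fin 3}
    (hd : d = 2 ↔ EvenMult k (k * (j + 1))) :
    HasPattern k (k * j + 1) (List.replicate (k - 1) 2 ++ [d]) := by
  refine HasPattern.append (fun i c hc => ?_) (fun i c hc => ?_)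
  · obtain ⟨hi, rfl⟩ : i < k - 1 ∧ (2 : Fin 3) = c := by
      simpa [List.getElem?_replicate] using hc
    refine iff_of_true rfl (evenMult_of_not_dvd ?_)
    rw [add_assoc, Nat.dvd_add_right (dvd_mul_right k j)]
    exact Nat.not_dvd_of_pos_of_lt (by omega) (by omega)
  · obtain ⟨rfl, rfl⟩ : i = 0 ∧ d = c := by
      rcases i with _ | i <;> simp_all
    have e : k * j + 1 + (List.replicate (k - 1) (2 : Fin 3)).length + 0 = k * (j + 1) := by
      simp only [List.length_replicate, mul_add]; omega
    rwa [e]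

/-- The random substitution `0, 1 ↦ {2^k}`, `2 ↦ {2^{k-1}0, 2^{k-1}1}`. -/
def toeplitzSubst (k : ℕ) : Fin 3 → Set (List (Fin 3)) := fun c =>
  if c = 2 then {List.replicate (k - 1) 2 ++ [0], List.replicate (k - 1) 2 ++ [1]}
  else {List.replicate k 2}

theorem exists_of_mem_toeplitzSubst (hk : 2 ≤ k) {c : Fin 3} {u : List (Fin 3)}
    (hu : u ∈ toeplitzSubst k c) :
    ∃ d : Fin 3, (d = 2 ↔ c ≠ 2) ∧ u = List.replicate (k - 1) 2 ++ [d] := by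
  unfold toeplitzSubst at hu
  split_ifs at hu with hc
  · rcases hu with rfl | rfl
    · exact ⟨0, by simp [hc], rfl⟩
    · exact ⟨1, by simp [hc], rfl⟩
  · refine ⟨2, by simp [hc], ?_⟩
    rw [← List.replicate_succ', Nat.sub_add_cancel (by omega)]
    exact hu

theorem length_of_mem_toeplitzSubst (hk : 2 ≤ k) (c : Fin 3) (u : List (Fin 3))
    (hu : u ∈ toeplitzSubst k c) : u.length = k := by
  obtain ⟨d, -, rfl⟩ := exists_of_mem_toeplitzSubst hk hu
  simp; omega

theorem toeplitzSubst_nonempty (k : ℕ) (c : Fin 3) : (toeplitzSubst k c).Nonempty := by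
  unfold toeplitzSubst
  split_ifs
  · exact Set.insert_nonempty _ _
  · exact Set.singleton_nonempty _

theorem HasPattern.of_mem_real (hk : 2 ≤ k) {j : ℕ} {w v : List (Fin 3)}
    (hw : HasPattern k (j + 1) w) (hv : v ∈ real (toeplitzSubst k) w) :
    HasPattern k (k * j + 1) v := by
  induction w generalizing j v with
  | nil => rw [show v = [] from hv]; intro i c hc; simp at hc
  | cons c w ih =>
    obtain ⟨u, hu, r, hr, rfl⟩ := hv
    have hlen := length_of_mem_toeplitzSubst hk c u hu
    refine HasPattern.append ?_ ?_
    · obtain ⟨d, hd, rfl⟩ := exists_of_mem_toeplitzSubst hk hu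
      refine hasPattern_replicate_append hk j ?_
      rw [hd, evenMult_mul_self hk j.succ_pos]
      exact not_congr (hw 0 c rfl)
    · have := ih hw.tail hr
      rwa [hlen, show k * j + 1 + k = k * (j + 1) + 1 by ring]

theorem HasPattern.of_mem_realPow (hk : 2 ≤ k) {m j : ℕ} {w v : List (Fin 3)}
    (hw : HasPattern k (j + 1) w) (hv : v ∈ realPow (toeplitzSubst k) m w) :
    ∃ d, HasPattern k (d + 1) v := by
  induction m generalizing j w with
  | zero => exact ⟨j, by rwa [show v = w from hv]⟩
  | succ m ih =>
    obtain ⟨u, hu, hv⟩ := Set.mem_iUnion₂.1 hv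
    exact ih (hw.of_mem_real hk hu) hv

theorem exists_hasPattern_singleton (hk : 2 ≤ k) (c : Fin 3) :
    ∃ j, HasPattern k (j + 1) [c] := by
  have h₁ : EvenMult k 1 := evenMult_of_not_dvd (by rw [Nat.dvd_one]; omega)
  have hsing : ∀ j, (c = 2 ↔ EvenMult k (j + 1)) → HasPattern k (j + 1) [c] := by
    intro j hj i d hd
    obtain ⟨rfl, rfl⟩ : i = 0 ∧ c = d := by
      rcases i with _ | i <;> simp_all
    exact hj
  by_cases hc : c = 2
  · exact ⟨0, hsing 0 (iff_of_true hc h₁)⟩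
  · refine ⟨k - 1, hsing _ (iff_of_false hc ?_)⟩
    rw [Nat.sub_add_cancel (by omega)]
    have := evenMult_mul_self hk one_pos
    rw [mul_one] at this
    exact fun h => this.1 h h₁

theorem Legal.exists_hasPattern (hk : 2 ≤ k) {u : List (Fin 3)}
    (hu : Legal (toeplitzSubst k) u) : ∃ j, HasPattern k j u := by
  obtain ⟨m, c, v, hv, huv⟩ := hu
  obtain ⟨j, hj⟩ := exists_hasPattern_singleton hk c
  obtain ⟨d, hd⟩ := hj.of_mem_realPow hk hv
  obtain ⟨e, he⟩ := hd.of_subword huv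
  exact ⟨_, he⟩

end Pattern

section Counting

open Classical in
/-- The words of length `n` whose pattern of letters `2` is that of `EvenMult k` from position
`r` on, with the positions divisible by `q` decided by `b` instead. -/
noncomputable def patternWords (k n q r : ℕ) (b : Prop) : Finset (Fin n → Fin 3) :=
  Fintype.piFinset fun i =>
    if (if q ∣ r + i then b else EvenMult k (r + i)) then {2} else {0, 1}

theorem card_filter_dvd_le (k n r : ℕ) :
    (Finset.univ.filter fun i : Fin n => k ∣ r + i).card ≤ n / k + 1 := by
  rw [← Finset.card_range (n / k + 1)]
  refine Finset.card_le_card_of_injOn (fun i => (i : ℕ) / k) (fun i _ => ?_) ?_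
  · simpa [Nat.lt_succ_iff] using Nat.div_le_div_right i.2.le
  · intro i hi j hj hij
    have hi : k ∣ r + i := by simpa using hi
    have hj : k ∣ r + j := by simpa using hj
    have h : r + (i : ℕ) ≡ r + j [MOD k] :=
      (Nat.modEq_zero_iff_dvd.2 hi).trans (Nat.modEq_zero_iff_dvd.2 hj).symm
    have h' : (i : ℕ) % k = j % k := Nat.ModEq.add_left_cancel' r h
    have hij : (i : ℕ) / k = j / k := hij
    refine Fin.ext ?_
    rw [← Nat.div_add_mod (i : ℕ) k, ← Nat.div_add_mod (j : ℕ) k, hij, h']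

theorem card_patternWords_le {k q : ℕ} (hq : k ∣ q) (n r : ℕ) (b : Prop) :
    (patternWords k n q r b).card ≤ 2 ^ (n / k + 1) := by
  classical
  rw [patternWords, Fintype.card_piFinset]
  calc _ ≤ ∏ i : Fin n, (if k ∣ r + i then 2 else 1) := by
        refine Finset.prod_le_prod' fun i _ => ?_
        by_cases h : k ∣ r + (i : ℕ)
        · rw [if_pos h]
          split_ifs <;> simp
        · have h' : ¬ q ∣ r + (i : ℕ) := fun h' => h (hq.trans h')
          simp [h, h', evenMult_of_not_dvd h]
    _ = 2 ^ (Finset.univ.filter fun i : Fin n => k ∣ r + i).card := by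
        rw [Finset.prod_ite]; simp
    _ ≤ _ := Nat.pow_le_pow_right (by norm_num) (card_filter_dvd_le k n r)

theorem HasPattern.exists_mem_patternWords {k n L j : ℕ} (hn : n ≤ k ^ L)
    {f : Fin n → Fin 3} (hf : HasPattern k j (List.ofFn f)) :
    ∃ b : Bool, f ∈ patternWords k n (k ^ L) (j % k ^ L) (b = true) := by
  classical
  refine ⟨decide (∃ i : Fin n, k ^ L ∣ j + i ∧ EvenMult k (j + i)), ?_⟩
  have hmod : ∀ i : ℕ, j % k ^ L + i ≡ j + i [MOD k ^ L] := fun i =>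
    (Nat.mod_modEq j _).add_right i
  refine Fintype.mem_piFinset.2 fun i => ?_
  have hi := hf i (f i) (by simp)
  have key : (if k ^ L ∣ j % k ^ L + i then
      (decide (∃ i : Fin n, k ^ L ∣ j + i ∧ EvenMult k (j + i)) = true)
      else EvenMult k (j % k ^ L + i)) ↔ f i = 2 := by
    rw [hi]
    split_ifs with h
    · have h₁ : k ^ L ∣ j + i := ((hmod i).dvd_iff dvd_rfl).1 h
      rw [decide_eq_true_iff]
      refine ⟨?_, fun h₂ => ⟨i, h₁, h₂⟩⟩
      rintro ⟨i', h₁', h₂'⟩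
      have hc : j + (i' : ℕ) ≡ j + i [MOD k ^ L] :=
        (Nat.modEq_zero_iff_dvd.2 h₁').trans (Nat.modEq_zero_iff_dvd.2 h₁).symm
      have := Nat.ModEq.eq_of_lt_of_lt (Nat.ModEq.add_left_cancel' j hc)
        (i'.2.trans_le hn) (i.2.trans_le hn)
      rwa [← this]
    · exact evenMult_congr h (hmod i)
  by_cases h2 : f i = 2
  · rw [if_pos (key.2 h2)]
    simpa using h2
  · rw [if_neg (mt key.1 h2)]
    generalize f i = c at h2
    fin_cases c <;> simp_all

theorem ncard_lang_le {k : ℕ} (hk : 2 ≤ k) {n : ℕ} (hn : n ≠ 0) :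
    (lang (X (toeplitzSubst k)) n).ncard ≤ 2 * (k * n) * 2 ^ (n / k + 1) := by
  classical
  set L := Nat.log k n + 1 with hL
  have hn' : n ≤ k ^ L := (Nat.lt_pow_succ_log_self (by omega) n).le
  have hL' : k ^ L ≤ k * n := by
    rw [hL, pow_succ']
    exact Nat.mul_le_mul_left k (Nat.pow_log_le_self k hn)
  let W : Finset (Fin n → Fin 3) := (Finset.range (k ^ L) ×ˢ (Finset.univ : Finset Bool)).biUnion
    fun p => patternWords k n (k ^ L) p.1 (p.2 = true)
  have hsub : lang (X (toeplitzSubst k)) n ⊆ ((W.image List.ofFn : Finset _) : Set _) := by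
    rintro u ⟨-, x, hx, i, rfl⟩
    obtain ⟨j, hj⟩ := (hx i n).exists_hasPattern hk
    obtain ⟨b, hb⟩ := HasPattern.exists_mem_patternWords hn' hj
    refine Finset.mem_coe.2 (Finset.mem_image.2 ⟨_, Finset.mem_biUnion.2
      ⟨(j % k ^ L, b), ?_, hb⟩, rfl⟩)
    simp [Nat.mod_lt j (show 0 < k ^ L by positivity)]
  calc _ ≤ (W.image List.ofFn).card := by
        rw [← Set.ncard_coe_finset]
        exact Set.ncard_le_ncard hsub (Finset.finite_toSet _)
    _ ≤ W.card := Finset.card_image_le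
    _ ≤ (Finset.range (k ^ L) ×ˢ (Finset.univ : Finset Bool)).card * 2 ^ (n / k + 1) :=
        Finset.card_biUnion_le_card_mul _ _ _ fun p _ =>
          card_patternWords_le (dvd_pow_self k (by omega)) n _ _
    _ ≤ _ := by
        refine Nat.mul_le_mul_right _ ?_
        rw [Finset.card_product, Finset.card_range, Finset.card_univ, Fintype.card_bool]
        omega

theorem entropy_le_of_ncard_lang_le {A : Type*} {Y : Set (ℤ → A)} {C c : ℝ} (hC : 1 ≤ C) (hc : 0 ≤ c)
    (h : ∀ n : ℕ, n ≠ 0 → ((lang Y n).ncard : ℝ) ≤ C * n * Real.exp (c * n)) :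
    entropy Y ≤ c := by
  have hlim : Filter.Tendsto (fun n : ℕ => Real.log C / n + Real.log n / n + c)
      Filter.atTop (nhds c) := by
    have h₁ : Filter.Tendsto (fun n : ℕ => Real.log C / n) Filter.atTop (nhds 0) :=
      tendsto_const_div_atTop_nhds_zero_nat _
    have h₂ : Filter.Tendsto (fun n : ℕ => Real.log n / n) Filter.atTop (nhds 0) :=
      Real.isLittleO_log_id_atTop.tendsto_div_nhds_zero.comp tendsto_natCast_atTop_atTop
    simpa using (h₁.add h₂).add_const c
  rw [← hlim.limsup_eq]
  refine Filter.limsup_le_limsup ?_ ?_ hlim.isBoundedUnder_le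
  · filter_upwards [Filter.eventually_ne_atTop 0] with n hn
    have hn' : (0 : ℝ) < n := by positivity
    have hC' : 0 < C := by positivity
    have hlog : Real.log (C * n * Real.exp (c * n)) = Real.log C + Real.log n + c * n := by
      rw [Real.log_mul (by positivity) (by positivity), Real.log_mul (by positivity) hn'.ne', Real.log_exp]
    have hle : Real.log (lang Y n).ncard ≤ Real.log C + Real.log n + c * n := by
      rcases Nat.eq_zero_or_pos (lang Y n).ncard with h0 | h0
      · rw [h0, Nat.cast_zero, Real.log_zero]
        have := Real.log_nonneg hC
        have := Real.log_natCast_nonneg n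
        positivity
      · rw [← hlog]
        exact Real.log_le_log (by exact_mod_cast h0) (h n hn)
    calc _ ≤ (Real.log C + Real.log n + c * n) / n := by gcongr
      _ = _ := by field_simp
  · exact Filter.IsBoundedUnder.isCoboundedUnder_le
      ⟨0, Filter.eventually_map.2 (Filter.Eventually.of_forall fun n =>
        div_nonneg (Real.log_natCast_nonneg _) n.cast_nonneg)⟩

theorem entropy_toeplitzSubst_le {k : ℕ} (hk : 2 ≤ k) :
    entropy (X (toeplitzSubst k)) ≤ (1 / (k : ℝ)) * Real.log 2 := by
  have hk' : (2 : ℝ) ≤ k := by exact_mod_cast hk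
  refine entropy_le_of_ncard_lang_le (C := 4 * k) (by linarith) (by positivity) fun n hn => ?_
  have hpow : (2 : ℝ) ^ (n / k) ≤ Real.exp (1 / (k : ℝ) * Real.log 2 * n) := by
    rw [← Real.exp_log (show (0 : ℝ) < 2 ^ (n / k) by positivity), Real.log_pow]
    refine Real.exp_le_exp.2 ?_
    calc ((n / k : ℕ) : ℝ) * Real.log 2 ≤ (n / k : ℝ) * Real.log 2 := by
          gcongr
          exact Nat.cast_div_le
      _ = _ := by ring
  calc ((lang (X (toeplitzSubst k)) n).ncard : ℝ) ≤ 2 * (k * n) * 2 ^ (n / k + 1) := by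
        exact_mod_cast ncard_lang_le hk hn
    _ = 4 * k * n * 2 ^ (n / k) := by ring
    _ ≤ _ := by gcongr

end Counting

theorem X_toeplitzSubst_nonempty {k : ℕ} (hk : 2 ≤ k) : (X (toeplitzSubst k)).Nonempty := by
  refine X_nonempty fun n => ?_
  obtain ⟨v, hv⟩ := realPow_nonempty (toeplitzSubst_nonempty k) n [2]
  refine ⟨v, ⟨n, 2, v, hv, List.infix_rfl⟩, ?_⟩
  rw [length_of_mem_realPow (length_of_mem_toeplitzSubst hk) hv]
  simpa using (Nat.lt_pow_self (by omega)).le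

theorem primitive_toeplitzSubst {k : ℕ} (hk : 2 ≤ k) : Primitive (toeplitzSubst k) := by
  obtain ⟨l, rfl⟩ : ∃ l, k = l + 2 := ⟨k - 2, by omega⟩
  have hhead : ∀ b : Fin 3, ∃ r, 2 :: r ∈ toeplitzSubst (l + 2) b := fun b => by
    obtain ⟨u, hu⟩ := toeplitzSubst_nonempty (l + 2) b
    obtain ⟨d, -, rfl⟩ := exists_of_mem_toeplitzSubst hk hu
    exact ⟨List.replicate l 2 ++ [d], by simpa [List.replicate_succ] using hu⟩
  have htwo : ∀ a : Fin 3, ∃ v ∈ toeplitzSubst (l + 2) 2, a ∈ v := fun a => by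
    fin_cases a
    · exact ⟨List.replicate (l + 1) 2 ++ [0], by simp [toeplitzSubst], by simp⟩
    · exact ⟨List.replicate (l + 1) 2 ++ [1], by simp [toeplitzSubst], by simp⟩
    · exact ⟨List.replicate (l + 1) 2 ++ [0], by simp [toeplitzSubst], by simp⟩
  refine ⟨2, fun a b => ?_⟩
  obtain ⟨r, hr⟩ := hhead b
  obtain ⟨v, hv, hav⟩ := htwo a
  obtain ⟨s, hs⟩ := real_nonempty (toeplitzSubst_nonempty (l + 2)) r
  refine ⟨v ++ s, Set.mem_biUnion (x := 2 :: r) ⟨_, hr, [], rfl, by simp⟩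
    (Set.mem_biUnion (x := v ++ s) ⟨v, hv, s, hs, rfl⟩ rfl), by simp [hav]⟩

end RS

/-- For `k ≥ 2`, the random substitution on the three-letter alphabet
`{a, ā, b} = {0, 1, 2}` given by `a, ā ↦ {b^k}` and `b ↦ {b^{k-1}a, b^{k-1}ā}` is primitive,
has nonempty RS-subshift, and its topological entropy is at most `(1/k) log 2`. -/
theorem stmt15 (k : ℕ) (hk : 2 ≤ k)
    (θ : Fin 3 → Set (List (Fin 3)))
    (hθ : θ = fun c : Fin 3 =>
      if c = 2 then
        ({List.replicate (k - 1) 2 ++ [0], List.replicate (k - 1) 2 ++ [1]} :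
          Set (List (Fin 3)))
      else {List.replicate k 2}) :
    RS.Primitive θ ∧ (RS.X θ).Nonempty ∧
      RS.entropy (RS.X θ) ≤ (1 / (k : ℝ)) * Real.log 2 := by
  subst hθ
  exact ⟨RS.primitive_toeplitzSubst hk, RS.X_toeplitzSubst_nonempty hk,
    RS.entropy_toeplitzSubst_le hk⟩
end
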